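/- arXiv:2507.19501 — 3 statements merged into one kernel-verified Lean document; each statement's English description precedes it below -/
import Mathlib

section
/- (Dual Gauss summation theorem.) Let â₁ = a₁ + ε a₁′, â₂ = a₂ + ε a₂′, b̂ = b + ε b′ be real dual numbers such that b, b − a₁, b − a₂ and b − a₁ − a₂ are each not equal to 0, −1, −2, …, and such that b − a₁ − a₂ > 0. Then (Σ_{k=0}^{∞} (â₁)_k (â₂)_k · Ring.inverse((b̂)_k) / k!) · Γ_d(b̂ − â₁) · Γ_d(b̂ − â₂) = Γ_d(b̂) · Γ_d(b̂ − â₁ − â₂), the sum (tsum) taken in DualNumber ℝ. -/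
open TrivSqZeroExt
open scoped DualNumber

/-- The dual gamma function `Γ_d(a + ε b) = Γ(a) + ε b Γ'(a)`. -/
noncomputable def dualGamma (a b : ℝ) : DualNumber ℝ :=
  inl (Real.Gamma a) + (b * deriv Real.Gamma a) • ε

/-- The dual shifted factorial `(â)_k = â(â+1)⋯(â+k-1)`. -/
def dualPoch (x : DualNumber ℝ) : ℕ → DualNumber ℝ
  | 0 => 1
  | k + 1 => dualPoch x k * (x + (k : DualNumber ℝ))

section GaussSeries

open Filter Topology Finset

/-- The `k`-th term `(a)_k (b)_k / ((c)_k k!)` of the Gauss series at `1`. -/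
def gaussTerm {K : Type*} [Field K] (a b c : K) (k : ℕ) : K :=
  ∏ j ∈ range k, (a + j) * (b + j) / ((c + j) * (j + 1))

lemma gaussTerm_zero {K : Type*} [Field K] (a b c : K) : gaussTerm a b c 0 = 1 := by
  simp [gaussTerm]

lemma gaussTerm_succ {K : Type*} [Field K] (a b c : K) (k : ℕ) :
    gaussTerm a b c (k + 1) =
      gaussTerm a b c k * ((a + k) * (b + k) / ((c + k) * (k + 1))) := by
  rw [gaussTerm, gaussTerm, prod_range_succ]

/-- Raabe's test. -/
lemma summable_of_raabe {M : ℕ → ℝ} {δ : ℝ} (hδ : 0 < δ) (hM : ∀ k, 0 ≤ M k)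
    (h : ∀ᶠ k : ℕ in atTop, δ * M k ≤ k * M k - (k + 1) * M (k + 1)) : Summable M := by
  obtain ⟨K, hK⟩ := eventually_atTop.1 h
  rw [← summable_nat_add_iff K]
  have key : ∀ n, δ * ∑ i ∈ range n, M (i + K) ≤ K * M K - (n + K) * M (n + K) := by
    intro n
    induction n with
    | zero => simp
    | succ n ih =>
      have := hK (n + K) (by omega)
      rw [sum_range_succ, mul_add]
      rw [show n + 1 + K = n + K + 1 by ring]
      push_cast at this ⊢
      linarith
  refine summable_of_sum_range_le (c := K * M K / δ) (fun n => hM _) fun n => ?_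
  rw [le_div_iff₀ hδ, mul_comm]
  have : 0 ≤ (n + K : ℝ) * M (n + K) := mul_nonneg (by positivity) (hM _)
  linarith [key n]

/-- A majorant of the Gauss series, uniform under perturbations of the parameters. -/
noncomputable def gaussMajorant (a b c e₁ e₂ e₃ : ℝ) (k : ℕ) : ℝ :=
  ∏ j ∈ range k, (|a + j| + e₁) * (|b + j| + e₂) / ((|c + j| - e₃) * (j + 1))

lemma summable_gaussMajorant {a b c e₁ e₂ e₃ : ℝ} (h₁ : 0 ≤ e₁) (h₂ : 0 ≤ e₂)
    (h₃ : ∀ j : ℕ, e₃ < |c + j|) (h : e₁ + e₂ + e₃ < c - a - b) :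
    Summable (gaussMajorant a b c e₁ e₂ e₃) := by
  have hδ : 0 < (c - a - b - (e₁ + e₂ + e₃)) / 2 := by linarith
  refine summable_of_raabe hδ (fun k => prod_nonneg fun j _ => ?_) ?_
  · have := h₃ j
    have : 0 < |c + j| - e₃ := by linarith
    positivity
  · set δ := (c - a - b - (e₁ + e₂ + e₃)) / 2 with hδdef
    have lim := tendsto_natCast_atTop_atTop (R := ℝ)
    filter_upwards [lim.eventually_ge_atTop (-a), lim.eventually_ge_atTop (-b),
      lim.eventually_ge_atTop (-c),
      lim.eventually_ge_atTop (((a + e₁) * (b + e₂) + δ * (c - e₃)) / δ)] with k ha hb hc hk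
    rw [div_le_iff₀ hδ] at hk
    have hck := h₃ k
    have hM : 0 ≤ gaussMajorant a b c e₁ e₂ e₃ k := by
      refine prod_nonneg fun j _ => ?_
      have := h₃ j
      have : 0 < |c + j| - e₃ := by linarith
      positivity
    have hs : gaussMajorant a b c e₁ e₂ e₃ (k + 1) = gaussMajorant a b c e₁ e₂ e₃ k *
        ((a + k + e₁) * (b + k + e₂) / ((c + k - e₃) * (k + 1))) := by
      rw [gaussMajorant, prod_range_succ, ← gaussMajorant, abs_of_nonneg (by linarith : 0 ≤ a + k),
        abs_of_nonneg (by linarith : 0 ≤ b + k), abs_of_nonneg (by linarith : 0 ≤ c + k)]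
    rw [abs_of_nonneg (by linarith : 0 ≤ c + k)] at hck
    have hpos : 0 < c + k - e₃ := by linarith
    have : k * gaussMajorant a b c e₁ e₂ e₃ k - (k + 1) * gaussMajorant a b c e₁ e₂ e₃ (k + 1) =
        gaussMajorant a b c e₁ e₂ e₃ k * (k - (a + k + e₁) * (b + k + e₂) / (c + k - e₃)) := by
      rw [hs]
      field_simp
    rw [this, mul_comm]
    refine mul_le_mul_of_nonneg_left ?_ hM
    rw [le_sub_iff_add_le, ← le_sub_iff_add_le', div_le_iff₀ hpos]
    nlinarith

lemma norm_gaussTerm_eq (a b c : ℝ) (k : ℕ) :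
    ‖gaussTerm a b c k‖ = gaussMajorant a b c 0 0 0 k := by
  rw [gaussTerm, gaussMajorant, norm_prod]
  refine prod_congr rfl fun j _ => ?_
  simp only [norm_div, norm_mul, Real.norm_eq_abs, add_zero, sub_zero]
  rw [abs_of_nonneg (by positivity : (0 : ℝ) ≤ j + 1)]

lemma add_natCast_ne_zero {c : ℝ} (hc : ∀ n : ℕ, c ≠ -n) (n : ℕ) : c + n ≠ 0 :=
  fun h => hc n (by linarith)

lemma summable_gaussTerm {a b c : ℝ} (hc : ∀ n : ℕ, c ≠ -n) (h : 0 < c - a - b) :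
    Summable (gaussTerm a b c) := by
  refine Summable.of_norm ?_
  simp_rw [norm_gaussTerm_eq]
  exact summable_gaussMajorant le_rfl le_rfl
    (fun j => abs_pos.2 (add_natCast_ne_zero hc j)) (by linarith)

lemma add_natCast_ne_neg {c : ℝ} (hc : ∀ n : ℕ, c ≠ -n) (m n : ℕ) : c + m ≠ -n := fun h =>
  hc (m + n) (by push_cast; linarith)

/-- If both `A` and `k A k - (k + 1) A (k + 1)` are summable, the latter sums to zero. -/
lemma hasSum_zero_of_summable {A : ℕ → ℝ} (hA : Summable A)
    (hD : Summable fun k : ℕ => k * A k - (k + 1) * A (k + 1)) :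
    HasSum (fun k : ℕ => k * A k - (k + 1) * A (k + 1)) 0 := by
  have hpart : ∀ n, ∑ k ∈ range n, ((k : ℝ) * A k - (k + 1) * A (k + 1)) = -(n * A n) := by
    intro n
    induction n with
    | zero => simp
    | succ n ih => rw [sum_range_succ, ih]; push_cast; ring
  have hlim := hD.hasSum.tendsto_sum_nat
  simp_rw [hpart] at hlim
  set s := ∑' k : ℕ, ((k : ℝ) * A k - (k + 1) * A (k + 1)) with hs
  suffices s = 0 by rw [← this]; exact hD.hasSum
  by_contra hne
  refine Real.not_summable_natCast_inv (summable_of_isBigO_nat hA.norm ?_)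
  have hev : ∀ᶠ n : ℕ in atTop, |s| / 2 < |(-(n * A n) : ℝ)| :=
    hlim.abs.eventually_const_lt (by linarith [abs_pos.2 hne])
  refine Asymptotics.IsBigO.of_bound (2 / |s|) ?_
  filter_upwards [hev, eventually_gt_atTop 0] with n hn hn0
  have hn0' : (0 : ℝ) < n := by exact_mod_cast hn0
  have hs0 := abs_pos.2 hne
  rw [abs_neg, abs_mul, abs_of_pos hn0'] at hn
  rw [norm_inv, norm_norm, Real.norm_eq_abs, Real.norm_eq_abs, abs_of_pos hn0', inv_le_iff_one_le_mul₀ hn0',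
    div_mul_eq_mul_div, div_mul_eq_mul_div, le_div_iff₀ hs0]
  linarith

lemma gaussTerm_add_one {a b c : ℝ} (hc : ∀ n : ℕ, c ≠ -n) (k : ℕ) :
    gaussTerm a b (c + 1) k = gaussTerm a b c k * (c / (c + k)) := by
  have h0 := add_natCast_ne_zero hc
  induction k with
  | zero => simp [gaussTerm_zero, div_self (by simpa using h0 0)]
  | succ k ih =>
    have h1 := h0 k
    have h2 := h0 (k + 1)
    rw [gaussTerm_succ, gaussTerm_succ, ih]
    push_cast at h2 ⊢
    have h3 : c + 1 + k ≠ 0 := by rwa [add_right_comm, add_assoc]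
    rw [add_assoc c, add_comm 1 (k : ℝ)]
    field_simp

lemma tsum_gaussTerm_contiguous {a b c : ℝ} (hc : ∀ n : ℕ, c ≠ -n) (h : 0 < c - a - b) :
    (∑' k, gaussTerm a b c k) * (c * (c - a - b)) =
      (c - a) * (c - b) * ∑' k, gaussTerm a b (c + 1) k := by
  have h0 := add_natCast_ne_zero hc
  have hA := summable_gaussTerm hc h
  have hB : Summable (gaussTerm a b (c + 1)) :=
    summable_gaussTerm (fun n => by simpa using add_natCast_ne_neg hc 1 n) (by linarith)
  have hc0 : c ≠ 0 := by simpa using h0 0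
  have hcomb := (hA.hasSum.mul_right (c - a - b)).sub (hB.hasSum.mul_left ((c - a) * (c - b) / c))
  have hfun : (fun k => gaussTerm a b c k * (c - a - b) -
      (c - a) * (c - b) / c * gaussTerm a b (c + 1) k) =
      fun k : ℕ => k * gaussTerm a b c k - (k + 1) * gaussTerm a b c (k + 1) := by
    ext k
    have := h0 k
    rw [gaussTerm_add_one hc, gaussTerm_succ]
    field_simp
    ring
  rw [hfun] at hcomb
  have := hcomb.unique (hasSum_zero_of_summable hA hcomb.summable)
  field_simp at this
  linarith

lemma tsum_gaussTerm_mul_prod {a b c : ℝ} (hc : ∀ n : ℕ, c ≠ -n) (h : 0 < c - a - b) (n : ℕ) :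
    (∑' k, gaussTerm a b c k) *
        ((∏ j ∈ range n, (c + j)) * ∏ j ∈ range n, (c - a - b + j)) =
      ((∏ j ∈ range n, (c - a + j)) * ∏ j ∈ range n, (c - b + j)) *
        ∑' k, gaussTerm a b (c + n) k := by
  induction n with
  | zero => simp
  | succ n ih =>
    have := tsum_gaussTerm_contiguous (a := a) (b := b) (add_natCast_ne_neg hc n)
      (by have : (0 : ℝ) ≤ n := by positivity
          linarith)
    simp only [prod_range_succ]
    push_cast
    rw [← add_assoc]
    linear_combination (c + n) * (c - a - b + n) * ih +
      (∏ j ∈ range n, (c - a + j)) * (∏ j ∈ range n, (c - b + j)) * this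

lemma tendsto_tsum_gaussTerm (a b c : ℝ) :
    Tendsto (fun n : ℕ => ∑' k, gaussTerm a b (c + n) k) atTop (𝓝 1) := by
  have lim := tendsto_natCast_atTop_atTop (R := ℝ)
  obtain ⟨N, hN⟩ := ((lim.eventually_gt_atTop (-c)).and
    (lim.eventually_gt_atTop (a + b - c))).exists
  have hNpos : 0 < c + N := by linarith
  have hone : ∑' k : ℕ, (∏ _j ∈ range k, (0 : ℝ)) = 1 := by
    rw [tsum_eq_single 0]
    · simp
    · intro k hk
      simp [hk]
  rw [← hone]
  refine tendsto_tsum_of_dominated_convergence (bound := fun k => ‖gaussTerm a b (c + N) k‖)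
    (summable_gaussTerm (fun n => ?_) (by linarith)).norm (fun k => ?_) ?_
  · have : (0 : ℝ) ≤ n := by positivity
    linarith
  · refine tendsto_finsetProd _ fun j _ => ?_
    refine tendsto_const_nhds.div_atTop (Tendsto.atTop_mul_const (by positivity) ?_)
    exact tendsto_atTop_add_const_right _ _ (tendsto_atTop_add_const_left _ _ lim)
  · filter_upwards [eventually_ge_atTop N] with n hn k
    have hn' : (N : ℝ) ≤ n := by exact_mod_cast hn
    rw [gaussTerm, gaussTerm, norm_prod, norm_prod]
    refine prod_le_prod (fun _ _ => norm_nonneg _) fun j _ => ?_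
    rw [norm_div, norm_div]
    have hj : (0 : ℝ) ≤ j := by positivity
    rw [Real.norm_of_nonneg (by nlinarith : 0 ≤ (c + n + j) * ((j : ℝ) + 1)),
      Real.norm_of_nonneg (by nlinarith : 0 ≤ (c + N + j) * ((j : ℝ) + 1))]
    gcongr

/-- Gauss's summation theorem for real parameters. -/
lemma tsum_gaussTerm_mul_Gamma {a b c : ℝ} (hc : ∀ n : ℕ, c ≠ -n) (hca : ∀ n : ℕ, c - a ≠ -n)
    (hcb : ∀ n : ℕ, c - b ≠ -n) (h : 0 < c - a - b) :
    (∑' k, gaussTerm a b c k) * Real.Gamma (c - a) * Real.Gamma (c - b) =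
      Real.Gamma c * Real.Gamma (c - a - b) := by
  have hl := (((Real.GammaSeq_tendsto_Gamma (c - a)).const_mul (∑' k, gaussTerm a b c k)).mul
    (Real.GammaSeq_tendsto_Gamma (c - b)))
  have hr := ((Real.GammaSeq_tendsto_Gamma c).mul (Real.GammaSeq_tendsto_Gamma (c - a - b))).mul
    ((tendsto_add_atTop_iff_nat 1).2 (tendsto_tsum_gaussTerm a b c))
  rw [mul_one] at hr
  refine tendsto_nhds_unique hl (hr.congr' ?_)
  filter_upwards [eventually_gt_atTop 0] with n hn
  have hn' : (0 : ℝ) < n := by exact_mod_cast hn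
  have key := tsum_gaussTerm_mul_prod hc h (n + 1)
  have hprod : ∀ {s : ℝ}, (∀ m : ℕ, s ≠ -m) → ∏ j ∈ range (n + 1), (s + j) ≠ 0 := fun hs =>
    prod_ne_zero_iff.2 fun j _ => add_natCast_ne_zero hs j
  have h1 := hprod hc
  have h2 := hprod hca
  have h3 := hprod hcb
  have h4 : ∏ j ∈ range (n + 1), (c - a - b + j) ≠ 0 :=
    prod_ne_zero_iff.2 fun j _ => by positivity
  have hpow : (n : ℝ) ^ (c - a) * (n : ℝ) ^ (c - b) = (n : ℝ) ^ c * (n : ℝ) ^ (c - a - b) := by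
    rw [← Real.rpow_add hn', ← Real.rpow_add hn']
    ring_nf
  simp only [Real.GammaSeq]
  generalize (n : ℝ) ^ (c - a) = p₁ at *
  generalize (n : ℝ) ^ (c - b) = p₂ at *
  generalize (n : ℝ) ^ c = p₃ at *
  generalize (n : ℝ) ^ (c - a - b) = p₄ at *
  generalize (∏ j ∈ range (n + 1), (c + j)) = q₁ at *
  generalize (∏ j ∈ range (n + 1), (c - a + j)) = q₂ at *
  generalize (∏ j ∈ range (n + 1), (c - b + j)) = q₃ at *
  generalize (∏ j ∈ range (n + 1), (c - a - b + j)) = q₄ at *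
  generalize (∑' k, gaussTerm a b (c + (n + 1 : ℕ)) k) = F at *
  generalize (∑' k, gaussTerm a b c k) = G at *
  field_simp
  linear_combination (-G * q₁ * q₄) * hpow - p₃ * p₄ * key

/-- `f` agrees to first order at `0` with the dual number `x`. -/
structure HasDualExpansion (f : ℂ → ℂ) (x : DualNumber ℝ) : Prop where
  apply_zero : f 0 = (x.fst : ℂ)
  hasDerivAt : HasDerivAt f (x.snd : ℂ) 0

namespace HasDualExpansion

lemma mul {f g : ℂ → ℂ} {x y : DualNumber ℝ} (hf : HasDualExpansion f x)
    (hg : HasDualExpansion g y) : HasDualExpansion (fun t => f t * g t) (x * y) where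
  apply_zero := by simp [hf.apply_zero, hg.apply_zero]
  hasDerivAt := by
    refine (hf.hasDerivAt.fun_mul hg.hasDerivAt).congr_deriv ?_
    simp [hf.apply_zero, hg.apply_zero]
    ring

lemma inverse {f : ℂ → ℂ} {x : DualNumber ℝ} (hf : HasDualExpansion f x) (hx : x.fst ≠ 0) :
    HasDualExpansion (fun t => (f t)⁻¹) (Ring.inverse x) := by
  have h := Ring.mul_inverse_cancel x (TrivSqZeroExt.isUnit_iff_isUnit_fst.2 hx.isUnit)
  have h1 := congrArg TrivSqZeroExt.fst h
  have h2 := congrArg TrivSqZeroExt.snd h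
  simp only [TrivSqZeroExt.fst_mul, TrivSqZeroExt.fst_one, TrivSqZeroExt.snd_mul,
    TrivSqZeroExt.snd_one, smul_eq_mul, MulOpposite.smul_eq_mul_unop, MulOpposite.unop_op] at h1 h2
  have h3 := eq_inv_of_mul_eq_one_right h1
  have h4 : (Ring.inverse x).snd = -x.snd / x.fst ^ 2 := by
    rw [h3] at h2
    field_simp at h2 ⊢
    linarith
  have hf0 : f 0 ≠ 0 := by
    rw [hf.apply_zero]
    exact_mod_cast hx
  refine ⟨by simp [hf.apply_zero, h3], ?_⟩
  refine (hf.hasDerivAt.fun_inv hf0).congr_deriv ?_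
  rw [h4, hf.apply_zero]
  push_cast
  ring

lemma real_smul {f : ℂ → ℂ} {x : DualNumber ℝ} (hf : HasDualExpansion f x) (r : ℝ) :
    HasDualExpansion (fun t => r * f t) (r • x) where
  apply_zero := by simp [hf.apply_zero]
  hasDerivAt := by
    refine (hf.hasDerivAt.const_mul (r : ℂ)).congr_deriv ?_
    simp

lemma linear (a a' : ℝ) (k : ℕ) :
    HasDualExpansion (fun t => a + t * a' + k) (inl a + a' • ε + (k : DualNumber ℝ)) where
  apply_zero := by simp
  hasDerivAt := by
    refine ((((hasDerivAt_id (0 : ℂ)).mul_const (a' : ℂ)).const_add (a : ℂ)).add_const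
      (k : ℂ)).congr_deriv ?_
    simp

end HasDualExpansion

/-- The dual Gauss terms are the first-order expansions of the ordinary ones. -/
lemma hasDualExpansion_gaussTerm (a₁ a₁' a₂ a₂' b b' : ℝ) (hb : ∀ n : ℕ, b ≠ -n) (k : ℕ) :
    HasDualExpansion (fun t => gaussTerm (a₁ + t * a₁') (a₂ + t * a₂') (b + t * b') k)
      ((k.factorial : ℝ)⁻¹ •
        (dualPoch (inl a₁ + a₁' • ε) k * dualPoch (inl a₂ + a₂' • ε) k *
          Ring.inverse (dualPoch (inl b + b' • ε) k))) := by
  induction k with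
  | zero => constructor <;> simp [gaussTerm_zero, dualPoch, hasDerivAt_const]
  | succ k ih =>
    have hfst : (inl b + b' • ε + (k : DualNumber ℝ)).fst ≠ 0 := by
      simpa using add_natCast_ne_zero hb k
    convert ih.mul ((((HasDualExpansion.linear a₁ a₁' k).mul (.linear a₂ a₂' k)).mul
      ((HasDualExpansion.linear b b' k).inverse hfst)).real_smul ((k + 1 : ℝ)⁻¹)) using 1
    · ext t
      rw [gaussTerm_succ]
      push_cast
      rw [div_eq_mul_inv, mul_inv]
      ring
    · simp only [dualPoch, Ring.mul_inverse_rev, Nat.factorial_succ, smul_mul_smul_comm]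
      push_cast
      rw [mul_inv, mul_comm ((k : ℝ) + 1)⁻¹]
      congr 1
      ring

lemma isOpen_ne_neg_natCast : IsOpen {x : ℝ | ∀ n : ℕ, x ≠ -n} := by
  have h := (Int.isClosedEmbedding_coe_real.isClosedMap _
    (isClosed_discrete (Set.range fun n : ℕ => -(n : ℤ)))).isOpen_compl
  convert h using 1
  ext x
  simp [eq_comm]

lemma eventually_ne_neg_natCast {x : ℝ} (hx : ∀ n : ℕ, x ≠ -n) (x' : ℝ) :
    ∀ᶠ t : ℝ in 𝓝 0, ∀ n : ℕ, x + t * x' ≠ -n := by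
  have hcont : ContinuousAt (fun t : ℝ => x + t * x') 0 := by fun_prop
  refine hcont.eventually_mem (isOpen_ne_neg_natCast.mem_nhds ?_)
  simpa using hx

lemma norm_linear_le (a a' : ℝ) {r : ℝ} {w : ℂ} (hw : ‖w‖ ≤ r) (j : ℕ) :
    ‖(a + w * a' + j : ℂ)‖ ≤ |a + j| + r * |a'| := by
  have h : (a + w * a' + j : ℂ) = ((a + j : ℝ) : ℂ) + w * a' := by push_cast; ring
  rw [h]
  refine (norm_add_le _ _).trans ?_
  rw [norm_mul, Complex.norm_real, Complex.norm_real, Real.norm_eq_abs, Real.norm_eq_abs]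
  gcongr

lemma le_norm_linear (a a' : ℝ) {r : ℝ} {w : ℂ} (hw : ‖w‖ ≤ r) (j : ℕ) :
    |a + j| - r * |a'| ≤ ‖(a + w * a' + j : ℂ)‖ := by
  have h : (a + w * a' + j : ℂ) = ((a + j : ℝ) : ℂ) + w * a' := by push_cast; ring
  rw [h]
  refine le_trans ?_ (norm_sub_le_norm_add _ _)
  rw [norm_mul, Complex.norm_real, Complex.norm_real, Real.norm_eq_abs, Real.norm_eq_abs]
  gcongr

lemma exists_radius {a₁' a₂' b b' d : ℝ} (hb : ∀ n : ℕ, b ≠ -n) (hd : 0 < d) :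
    ∃ r > 0, (∀ j : ℕ, r * |b'| < |b + j|) ∧ r * |a₁'| + r * |a₂'| + r * |b'| < d := by
  obtain ⟨c, hc, hball⟩ := Metric.isOpen_iff.1 isOpen_ne_neg_natCast b hb
  have hcb : ∀ j : ℕ, c ≤ |b + j| := by
    intro j
    by_contra! hlt
    have hmem : (-j : ℝ) ∈ Metric.ball b c := by
      rwa [Metric.mem_ball, dist_comm, Real.dist_eq, sub_neg_eq_add]
    exact hball hmem j rfl
  have h1 : ∀ᶠ r : ℝ in 𝓝 0, r * |b'| < c :=
    ContinuousAt.eventually_lt (by fun_prop) (by fun_prop) (by simpa using hc)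
  have h2 : ∀ᶠ r : ℝ in 𝓝 0, r * |a₁'| + r * |a₂'| + r * |b'| < d :=
    ContinuousAt.eventually_lt (by fun_prop) (by fun_prop) (by simpa using hd)
  obtain ⟨r, ⟨hr1, hr2⟩, hr⟩ := (((h1.and h2).filter_mono nhdsWithin_le_nhds).and
    (self_mem_nhdsWithin (a := (0 : ℝ)) (s := Set.Ioi 0))).exists
  exact ⟨r, hr, fun j => hr1.trans_le (hcb j), hr2⟩

lemma norm_gaussTerm_le {a₁ a₁' a₂ a₂' b b' r : ℝ} {w : ℂ} (hw : ‖w‖ ≤ r)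
    (hr : ∀ j : ℕ, r * |b'| < |b + j|) (k : ℕ) :
    ‖gaussTerm (a₁ + w * a₁') (a₂ + w * a₂') (b + w * b') k‖ ≤
      gaussMajorant a₁ a₂ b (r * |a₁'|) (r * |a₂'|) (r * |b'|) k := by
  rw [gaussTerm, gaussMajorant, norm_prod]
  refine prod_le_prod (fun _ _ => norm_nonneg _) fun j _ => ?_
  have hj : ‖(j + 1 : ℂ)‖ = j + 1 := by
    exact_mod_cast Complex.norm_natCast (j + 1)
  have hr0 : 0 ≤ r := (norm_nonneg w).trans hw
  have hpos : 0 < |b + j| - r * |b'| := sub_pos.2 (hr j)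
  rw [norm_div, norm_mul, norm_mul, hj]
  gcongr
  · exact norm_linear_le _ _ hw _
  · exact norm_linear_le _ _ hw _
  · exact le_norm_linear _ _ hw _

lemma differentiableOn_gaussTerm {a₁ a₁' a₂ a₂' b b' r : ℝ}
    (hr : ∀ j : ℕ, r * |b'| < |b + j|) (k : ℕ) :
    DifferentiableOn ℂ (fun w : ℂ => gaussTerm (a₁ + w * a₁') (a₂ + w * a₂') (b + w * b') k)
      (Metric.ball 0 r) := by
  simp only [gaussTerm]
  refine DifferentiableOn.fun_finsetProd fun j _ => ?_
  refine DifferentiableOn.fun_div (by fun_prop) (by fun_prop) fun w hw => ?_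
  refine mul_ne_zero ?_ (Nat.cast_add_one_ne_zero j)
  rw [← norm_pos_iff]
  exact (sub_pos.2 (hr j)).trans_le
    (le_norm_linear b b' (mem_ball_zero_iff.1 hw).le j)

/-- The Gauss series may be differentiated term by term along a line in parameter space. -/
lemma exists_hasSum_snd_hasDerivAt (a₁ a₁' a₂ a₂' b b' : ℝ) (hb : ∀ n : ℕ, b ≠ -n)
    (hpos : 0 < b - a₁ - a₂) :
    ∃ D : ℝ, HasSum (fun k : ℕ => ((k.factorial : ℝ)⁻¹ •
        (dualPoch (inl a₁ + a₁' • ε) k * dualPoch (inl a₂ + a₂' • ε) k *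
          Ring.inverse (dualPoch (inl b + b' • ε) k))).snd) D ∧
      HasDerivAt (fun t : ℝ => ∑' k, gaussTerm (a₁ + t * a₁') (a₂ + t * a₂') (b + t * b') k)
        D 0 := by
  obtain ⟨r, hr0, hr, hrd⟩ := exists_radius (a₁' := a₁') (a₂' := a₂') (b' := b') hb hpos
  have hsum : Summable (gaussMajorant a₁ a₂ b (r * |a₁'|) (r * |a₂'|) (r * |b'|)) :=
    summable_gaussMajorant (by positivity) (by positivity) hr hrd
  have hdiff := fun k => differentiableOn_gaussTerm (a₁ := a₁) (a₁' := a₁') (a₂ := a₂)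
    (a₂' := a₂') hr k
  have hle : ∀ (k : ℕ), ∀ w ∈ Metric.ball (0 : ℂ) r,
      ‖gaussTerm (a₁ + w * a₁') (a₂ + w * a₂') (b + w * b') k‖ ≤ _ := fun k w hw =>
    norm_gaussTerm_le (mem_ball_zero_iff.1 hw).le hr k
  have h0 : (0 : ℂ) ∈ Metric.ball (0 : ℂ) r := Metric.mem_ball_self hr0
  have hderiv := Complex.hasSum_deriv_of_summable_norm hsum hdiff Metric.isOpen_ball hle h0
  have hS := ((Complex.differentiableOn_tsum_of_summable_norm hsum hdiff Metric.isOpen_ball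
    hle).differentiableAt (Metric.isOpen_ball.mem_nhds h0)).hasDerivAt
  refine ⟨(deriv (fun w : ℂ =>
    ∑' k, gaussTerm (a₁ + w * a₁') (a₂ + w * a₂') (b + w * b') k) 0).re, ?_, ?_⟩
  · convert Complex.reCLM.hasSum hderiv using 1
    · ext k
      simp [(hasDualExpansion_gaussTerm a₁ a₁' a₂ a₂' b b' hb k).hasDerivAt.deriv]
    · rfl
  · rw [← Complex.ofReal_zero] at hS
    refine hS.real_of_complex.congr_of_eventuallyEq (.of_forall fun t => ?_)
    dsimp only
    rw [← Complex.ofReal_re (∑' k, gaussTerm _ _ _ k), Complex.ofReal_tsum]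
    simp [gaussTerm]

lemma hasDerivAt_Gamma_linear {x : ℝ} (hx : ∀ n : ℕ, x ≠ -n) (x' : ℝ) :
    HasDerivAt (fun t : ℝ => Real.Gamma (x + t * x')) (x' * deriv Real.Gamma x) 0 := by
  have hlin : HasDerivAt (fun t : ℝ => x + t * x') x' 0 := by
    simpa using ((hasDerivAt_id (0 : ℝ)).mul_const x').const_add x
  have hG : HasDerivAt Real.Gamma (deriv Real.Gamma x) (x + 0 * x') := by
    simpa using (Real.differentiableAt_Gamma hx).hasDerivAt
  rw [mul_comm]
  exact hG.comp 0 hlin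


end GaussSeries

/-- The dual Gauss summation theorem:
`₂F₁(â₁, â₂; b̂; 1) Γ_d(b̂-â₁) Γ_d(b̂-â₂) = Γ_d(b̂) Γ_d(b̂-â₁-â₂)`. -/
theorem dual_gauss_summation (a₁ a₁' a₂ a₂' b b' : ℝ)
    (hb : ∀ n : ℕ, b ≠ -n) (hba₁ : ∀ n : ℕ, b - a₁ ≠ -n) (hba₂ : ∀ n : ℕ, b - a₂ ≠ -n)
    (hba : ∀ n : ℕ, b - a₁ - a₂ ≠ -n) (hpos : 0 < b - a₁ - a₂) :
    (∑' k : ℕ, (k.factorial : ℝ)⁻¹ •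
          (dualPoch (inl a₁ + a₁' • ε) k * dualPoch (inl a₂ + a₂' • ε) k *
            Ring.inverse (dualPoch (inl b + b' • ε) k))) *
        dualGamma (b - a₁) (b' - a₁') * dualGamma (b - a₂) (b' - a₂') =
      dualGamma b b' * dualGamma (b - a₁ - a₂) (b' - a₁' - a₂') := by
  have hfst : HasSum (fun k : ℕ => ((k.factorial : ℝ)⁻¹ •
      (dualPoch (inl a₁ + a₁' • ε) k * dualPoch (inl a₂ + a₂' • ε) k *
        Ring.inverse (dualPoch (inl b + b' • ε) k))).fst) (∑' k, gaussTerm a₁ a₂ b k) := by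
    convert (summable_gaussTerm hb hpos).hasSum using 1
    ext k
    have := (hasDualExpansion_gaussTerm a₁ a₁' a₂ a₂' b b' hb k).apply_zero
    rw [← Complex.ofReal_inj, ← this]
    simp [gaussTerm]
  obtain ⟨D, hsnd, hD⟩ := exists_hasSum_snd_hasDerivAt a₁ a₁' a₂ a₂' b b' hb hpos
  have htsum := ((TrivSqZeroExt.hasSum_inl ℝ hfst).add (TrivSqZeroExt.hasSum_inr ℝ hsnd)).tsum_eq
  simp only [TrivSqZeroExt.inl_fst_add_inr_snd_eq] at htsum
  rw [htsum]
  have hgauss := tsum_gaussTerm_mul_Gamma hb hba₁ hba₂ hpos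
  have hev : ∀ᶠ t : ℝ in nhds 0,
      (∑' k, gaussTerm (a₁ + t * a₁') (a₂ + t * a₂') (b + t * b') k) *
        Real.Gamma (b - a₁ + t * (b' - a₁')) * Real.Gamma (b - a₂ + t * (b' - a₂')) =
      Real.Gamma (b + t * b') * Real.Gamma (b - a₁ - a₂ + t * (b' - a₁' - a₂')) := by
    have hpos' : ∀ᶠ t : ℝ in nhds 0, 0 < b - a₁ - a₂ + t * (b' - a₁' - a₂') :=
      ContinuousAt.eventually_lt (by fun_prop) (by fun_prop) (by simpa using hpos)
    filter_upwards [eventually_ne_neg_natCast hb b', eventually_ne_neg_natCast hba₁ (b' - a₁'),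
      eventually_ne_neg_natCast hba₂ (b' - a₂'), hpos'] with t h1 h2 h3 h4
    have e1 : b - a₁ + t * (b' - a₁') = b + t * b' - (a₁ + t * a₁') := by ring
    have e2 : b - a₂ + t * (b' - a₂') = b + t * b' - (a₂ + t * a₂') := by ring
    have e3 : b - a₁ - a₂ + t * (b' - a₁' - a₂') =
      b + t * b' - (a₁ + t * a₁') - (a₂ + t * a₂') := by ring
    rw [e1] at h2 ⊢
    rw [e2] at h3 ⊢
    rw [e3] at h4 ⊢
    exact tsum_gaussTerm_mul_Gamma h1 h2 h3 h4
  have hderiv := ((hD.fun_mul (hasDerivAt_Gamma_linear hba₁ (b' - a₁'))).fun_mul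
    (hasDerivAt_Gamma_linear hba₂ (b' - a₂'))).unique
    (((hasDerivAt_Gamma_linear hb b').fun_mul
      (hasDerivAt_Gamma_linear hba (b' - a₁' - a₂'))).congr_of_eventuallyEq hev)
  simp only [zero_mul, add_zero] at hderiv
  ext
  · simpa [dualGamma] using hgauss
  · simp [dualGamma]
    linear_combination hderiv
end

section
/- (Dual Pfaff transformation.) Let â₁, â₂, b̂ be real dual numbers with the real part of b̂ not equal to 0, −1, −2, …, and let x̂ = x₁ + ε x₂ with |x₁| < 1 and |x₁/(1 − x₁)| < 1. Then ₂F₁(â₁, â₂; b̂; x̂) = (1 − x̂)^{−â₁} · ₂F₁(â₁, b̂ − â₂; b̂; −x̂ · (1 − x̂)⁻¹), where (1 − x̂)⁻¹ is the dual-number inverse (valid since 1 − x₁ ≠ 0) and (1 − x̂)^{−â₁} is the dual power. -/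
open TrivSqZeroExt
open scoped DualNumber

/-- The dual power `ŵ^ĉ = w₁^{c₁} (1 + ε (c₂ log w₁ + c₁ w₂ / w₁))`, for `w₁ > 0`. -/
noncomputable def dualPow (w c : DualNumber ℝ) : DualNumber ℝ :=
  inl (w.fst ^ c.fst) * (1 + (c.snd * Real.log w.fst + c.fst * w.snd / w.fst) • ε)

/-- The dual Gauss hypergeometric function `₂F₁(â₁, â₂; b̂; x̂)`. -/
noncomputable def dualGaussHyper (a₁ a₂ b x : DualNumber ℝ) : DualNumber ℝ :=
  ∑' k : ℕ, (k.factorial : ℝ)⁻¹ •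
    (dualPoch a₁ k * dualPoch a₂ k * Ring.inverse (dualPoch b k) * x ^ k)

open Polynomial in
/-- The Chu–Vandermonde identity, cleared of denominators. -/
theorem sum_antidiagonal_choose_mul_ascPochhammer {R : Type*} [CommRing R] (n : ℕ) (b c : R) :
    ∑ p ∈ Finset.HasAntidiagonal.antidiagonal n,
        (n.choose p.1 : R) *
      ((-1) ^ p.1 * (ascPochhammer R p.1).eval c * (ascPochhammer R p.2).eval (b + p.1)) =
      (ascPochhammer R n).eval (b - c) := by
  induction n generalizing b c with
  | zero => simp
  | succ n ih =>
    rw [Finset.sum_antidiagonal_choose_succ_mul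
      (fun i j => (-1) ^ i * (ascPochhammer R i).eval c * (ascPochhammer R j).eval (b + i)) n,
      ascPochhammer_succ_eval]
    have h : ∑ p ∈ Finset.HasAntidiagonal.antidiagonal n,
        (n.choose p.2 : R) *
        ((-1) ^ (p.1 + 1) * (ascPochhammer R (p.1 + 1)).eval c *
          (ascPochhammer R p.2).eval (b + (p.1 + 1 : ℕ))) =
        -c * ∑ p ∈ Finset.HasAntidiagonal.antidiagonal n,
        (n.choose p.1 : R) *
        ((-1) ^ p.1 * (ascPochhammer R p.1).eval (c + 1) *
          (ascPochhammer R p.2).eval (b + 1 + p.1)) := by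
      rw [Finset.mul_sum]
      refine Finset.sum_congr rfl fun p hp => ?_
      rw [Finset.HasAntidiagonal.mem_antidiagonal] at hp
      rw [← Nat.choose_symm_of_eq_add hp.symm, ascPochhammer_succ_left]
      simp only [eval_mul, eval_X, eval_comp, eval_add, eval_one]
      rw [show b + ((p.1 + 1 : ℕ) : R) = b + 1 + p.1 by push_cast; ring]
      ring
    rw [h, ih (b + 1) (c + 1), show b + 1 - (c + 1) = b - c by ring]
    have h' : ∑ p ∈ Finset.HasAntidiagonal.antidiagonal n, (n.choose p.1 : R) *
        ((-1) ^ p.1 * (ascPochhammer R p.1).eval c *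
          (ascPochhammer R (p.2 + 1)).eval (b + p.1)) =
        (b + n) * (ascPochhammer R n).eval (b - c) := by
      rw [← ih b c, Finset.mul_sum]
      refine Finset.sum_congr rfl fun p hp => ?_
      rw [Finset.HasAntidiagonal.mem_antidiagonal] at hp
      rw [ascPochhammer_succ_eval, ← hp]
      push_cast
      ring
    rw [h']
    ring

theorem ascPochhammer_eval_add {R : Type*} [CommRing R] (a : R) (n m : ℕ) :
    (ascPochhammer R n).eval a * (ascPochhammer R m).eval (a + n) =
      (ascPochhammer R (n + m)).eval a := by
  simp [← ascPochhammer_mul]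

theorem isUnit_ascPochhammer_eval {R : Type*} [CommRing R] {b : R}
    (hb : ∀ k : ℕ, IsUnit (b + k)) (n : ℕ) : IsUnit ((ascPochhammer R n).eval b) := by
  induction n with
  | zero => simp
  | succ n ih => rw [ascPochhammer_succ_eval]; exact ih.mul (hb n)

section PowerSeries

variable {E : Type*} [NormedAddCommGroup E] [NormedSpace ℝ E] [CompleteSpace E] {c : ℕ → E}

theorem analyticOnNhd_tsum_pow_smul
    (hc : ∀ r : ℝ, |r| < 1 → Summable fun n => ‖c n‖ * |r| ^ n) :
    AnalyticOnNhd ℝ (fun s : ℝ => ∑' n, s ^ n • c n) (Metric.ball 0 1) := by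
  let p : FormalMultilinearSeries ℝ ℝ E :=
    fun n => ContinuousMultilinearMap.mkPiRing ℝ (Fin n) (c n)
  have hp : 1 ≤ p.radius := by
    refine ENNReal.le_of_forall_nnreal_lt fun r hr => p.le_radius_of_summable ?_
    have hr' : |(r : ℝ)| < 1 := by
      rw [NNReal.abs_eq]
      exact_mod_cast hr
    simpa [p, ContinuousMultilinearMap.norm_mkPiRing] using hc r hr'
  have hsum : p.sum = fun s : ℝ => ∑' n, s ^ n • c n := by
    ext s
    simp [p, FormalMultilinearSeries.sum]
  rw [← hsum]
  refine (p.hasFPowerSeriesOnBall (one_pos.trans_le hp)).analyticOnNhd.mono fun s hs => ?_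
  refine Metric.eball_subset_eball hp ?_
  simpa [← ENNReal.ofReal_one, Metric.eball_ofReal] using hs

theorem summable_pow_smul (hc : ∀ r : ℝ, |r| < 1 → Summable fun n => ‖c n‖ * |r| ^ n)
    {s : ℝ} (hs : |s| < 1) : Summable fun n => s ^ n • c n :=
  .of_norm_bounded (hc s hs) fun n => by simp [norm_smul, mul_comm]

theorem hasDerivAt_tsum_pow_smul
    (hc : ∀ r : ℝ, |r| < 1 → Summable fun n => ‖c n‖ * |r| ^ n) {s : ℝ} (hs : |s| < 1) :
    ∃ d : E, HasDerivAt (fun s : ℝ => ∑' n, s ^ n • c n) d s ∧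
      HasSum (fun n : ℕ => (n * s ^ (n - 1)) • c n) d := by
  obtain ⟨r, hsr, hr⟩ := exists_between hs
  obtain ⟨q, hrq, hq⟩ := exists_between hr
  have hr0 : 0 < r := (abs_nonneg s).trans_lt hsr
  have hq0 : 0 < q := hr0.trans hrq
  have hu : Summable fun n : ℕ => (n * r ^ (n - 1)) * ‖c n‖ := by
    have hbig := hc q (by rwa [abs_of_pos hq0])
    have hlim : Filter.Tendsto (fun n : ℕ => (n : ℝ) * (r / q) ^ n) Filter.atTop (nhds 0) :=
      tendsto_self_mul_const_pow_of_lt_one (by positivity) ((div_lt_one hq0).2 hrq)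
    refine summable_of_isBigO_nat hbig ?_
    refine Asymptotics.IsBigO.of_bound r⁻¹ ?_
    filter_upwards [hlim.eventually (gt_mem_nhds one_pos)] with n hn
    rw [div_pow, ← mul_div_assoc, div_lt_one (by positivity)] at hn
    rw [Real.norm_of_nonneg (by positivity), Real.norm_of_nonneg (by positivity),
      abs_of_pos hq0]
    rcases n with _ | n
    · simp; positivity
    · rw [Nat.add_sub_cancel, inv_mul_eq_div, le_div_iff₀ hr0]
      calc _ = ((n + 1 : ℕ) * r ^ (n + 1)) * ‖c (n + 1)‖ := by ring
        _ ≤ _ := by rw [mul_comm]; gcongr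
  have hbound : ∀ (n : ℕ) (y : ℝ), y ∈ Metric.ball (0 : ℝ) r →
      ‖(n * y ^ (n - 1)) • c n‖ ≤ (n * r ^ (n - 1)) * ‖c n‖ := by
    intro n y hy
    rw [mem_ball_zero_iff, Real.norm_eq_abs] at hy
    rw [norm_smul, norm_mul, norm_pow, Real.norm_natCast, Real.norm_eq_abs]
    gcongr
  have hsr' : s ∈ Metric.ball (0 : ℝ) r := by simpa using hsr
  refine ⟨_, hasDerivAt_tsum_of_isPreconnected hu Metric.isOpen_ball
    (convex_ball 0 r).isPreconnected (fun n y _ => (hasDerivAt_pow n y).smul_const (c n))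
    hbound hsr' (summable_pow_smul hc hs) hsr', ?_⟩
  exact (Summable.of_norm_bounded hu fun n => hbound n s hsr').hasSum

end PowerSeries

section Hypergeometric

variable {A : Type*} [NormedCommRing A] [NormedAlgebra ℝ A]

/-- The `n`-th coefficient of the Gauss hypergeometric series with parameters in a real algebra. -/
noncomputable def gaussCoeff (a₁ a₂ b : A) (n : ℕ) : A :=
  (n.factorial : ℝ)⁻¹ • ((ascPochhammer A n).eval a₁ * (ascPochhammer A n).eval a₂ *
    Ring.inverse ((ascPochhammer A n).eval b))

/-- The `n`-th coefficient of the binomial series of `(1 - s) ^ (-a)`. -/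
noncomputable def binomCoeff (a : A) (n : ℕ) : A :=
  (n.factorial : ℝ)⁻¹ • (ascPochhammer A n).eval a

theorem gaussCoeff_self {a b : A} (hb : ∀ k : ℕ, IsUnit (b + k)) :
    gaussCoeff a b b = binomCoeff a := by
  ext n
  rw [gaussCoeff, binomCoeff, mul_assoc, Ring.mul_inverse_cancel _ (isUnit_ascPochhammer_eval hb n),
    mul_one]

theorem ringInverse_smul {r : ℝ} (hr : r ≠ 0) (x : A) :
    Ring.inverse (r • x) = r⁻¹ • Ring.inverse x := by
  have hu : IsUnit (algebraMap ℝ A r) := (IsUnit.mk0 r hr).map _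
  have h : Ring.inverse (algebraMap ℝ A r) = algebraMap ℝ A r⁻¹ := by
    rw [← one_mul (Ring.inverse _), eq_comm, Ring.eq_mul_inverse_iff_mul_eq _ _ _ hu, ← map_mul,
      inv_mul_cancel₀ hr, map_one]
  rw [Algebra.smul_def, Ring.inverse_mul (.inl hu), h, mul_comm, ← Algebra.smul_def]

theorem gaussCoeff_succ (a₁ a₂ b : A) (n : ℕ) :
    gaussCoeff a₁ a₂ b (n + 1) =
      ((n + 1 : ℝ)⁻¹ • (a₁ + n)) * ((n + 1 : ℝ)⁻¹ • (a₂ + n)) *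
        Ring.inverse ((n + 1 : ℝ)⁻¹ • (b + n)) * gaussCoeff a₁ a₂ b n := by
  have hn : (n + 1 : ℝ) ≠ 0 := by positivity
  have hinv : Ring.inverse ((n + 1 : ℝ)⁻¹ • (b + n)) = (n + 1 : ℝ) • Ring.inverse (b + n) := by
    rw [ringInverse_smul (inv_ne_zero hn), inv_inv]
  rw [hinv]
  simp only [gaussCoeff, ascPochhammer_succ_eval, Ring.mul_inverse_rev, Nat.factorial_succ,
    smul_mul_assoc, mul_smul_comm, smul_smul]
  push_cast
  congr 1
  · field_simp
  · ring

theorem succ_smul_binomCoeff_succ (a : A) (n : ℕ) :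
    (n + 1 : ℝ) • binomCoeff a (n + 1) = (a + n) * binomCoeff a n := by
  have hn : (n + 1 : ℝ) ≠ 0 := by positivity
  simp only [binomCoeff, ascPochhammer_succ_eval, Nat.factorial_succ, mul_smul_comm, smul_smul]
  push_cast
  congr 1
  · field_simp
  · ring

theorem tendsto_inv_smul_add_natCast (a : A) :
    Filter.Tendsto (fun n : ℕ => (n + 1 : ℝ)⁻¹ • (a + n)) Filter.atTop (nhds 1) := by
  have h : ∀ n : ℕ, (n + 1 : ℝ)⁻¹ • (a + n) = (n + 1 : ℝ)⁻¹ • (a - 1) + 1 := fun n => by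
    have hn : (n + 1 : ℝ) ≠ 0 := by positivity
    have h1 : (1 : A) = (n + 1 : ℝ)⁻¹ • (n + 1 : A) := by
      rw [eq_inv_smul_iff₀ hn, add_smul, one_smul, Nat.cast_smul_eq_nsmul, nsmul_one]
    calc _ = (n + 1 : ℝ)⁻¹ • (a - 1) + (n + 1 : ℝ)⁻¹ • (n + 1 : A) := by
          rw [← smul_add]; congr 1; ring
      _ = _ := by rw [← h1]
  simp only [h]
  have h0 : Filter.Tendsto (fun n : ℕ => (n + 1 : ℝ)⁻¹) Filter.atTop (nhds 0) := by
    simpa using tendsto_one_div_add_atTop_nhds_zero_nat (𝕜 := ℝ)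
  simpa using (h0.smul_const (a - 1)).add_const 1

/-- The power `(1 - s) ^ (-a)` with exponent in a real Banach algebra. -/
noncomputable def oneSubPow (a : A) (s : ℝ) : A := NormedSpace.exp ((-Real.log (1 - s)) • a)

theorem oneSubPow_zero (a : A) : oneSubPow a 0 = 1 := by simp [oneSubPow]

variable [CompleteSpace A]

theorem hasDerivAt_oneSubPow (a : A) {s : ℝ} (hs : s < 1) :
    HasDerivAt (oneSubPow a) ((1 - s)⁻¹ • (a * oneSubPow a s)) s := by
  have h1 : HasDerivAt (fun s : ℝ => -Real.log (1 - s)) (1 - s)⁻¹ s := by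
    have := (((hasDerivAt_id s).const_sub 1).log (by simp; linarith)).neg
    simpa [neg_div] using! this
  have h2 := (hasDerivAt_exp_smul_const' (𝕂 := ℝ) a (-Real.log (1 - s))).scomp s h1
  exact h2

theorem oneSubPow_neg_mul (a : A) (s : ℝ) : oneSubPow (-a) s * oneSubPow a s = 1 := by
  let _ : NormedAlgebra ℚ A := .restrictScalars ℚ ℝ A
  rw [oneSubPow, oneSubPow, ← NormedSpace.exp_add, ← smul_add, neg_add_cancel, smul_zero,
    NormedSpace.exp_zero]

theorem analyticAt_oneSubPow (a : A) {s : ℝ} (hs : s < 1) : AnalyticAt ℝ (oneSubPow a) s := by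
  have h1 : AnalyticAt ℝ (fun s : ℝ => (-Real.log (1 - s)) • a) s :=
    ((analyticAt_const.sub analyticAt_id).log (by simpa using hs)).neg.smul analyticAt_const
  exact (NormedSpace.exp_analytic (𝕂 := ℝ) _).comp h1

theorem oneSubPow_add_natCast (a : A) (k : ℕ) {s : ℝ} (hs : s < 1) :
    oneSubPow (a + k) s = ((1 - s)⁻¹ ^ k) • oneSubPow a s := by
  have h : (-Real.log (1 - s)) • (k : A) = algebraMap ℝ A (Real.log ((1 - s)⁻¹ ^ k)) := by
    rw [Real.log_pow, Real.log_inv, Algebra.smul_def, map_mul, map_natCast, mul_comm]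
  let _ : NormedAlgebra ℚ A := .restrictScalars ℚ ℝ A
  have hpos : 0 < (1 - s)⁻¹ ^ k := by have := sub_pos.2 hs; positivity
  rw [oneSubPow, smul_add, NormedSpace.exp_add, h, ← NormedSpace.algebraMap_exp_comm,
    ← Real.exp_eq_exp_ℝ, Real.exp_log hpos, mul_comm, ← Algebra.smul_def, oneSubPow]

variable [NormOneClass A]

theorem summable_norm_gaussCoeff_mul_pow (a₁ a₂ b : A) (r : ℝ) (hr : |r| < 1) :
    Summable fun n => ‖gaussCoeff a₁ a₂ b n‖ * |r| ^ n := by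
  have hq : Filter.Tendsto (fun n : ℕ => ((n + 1 : ℝ)⁻¹ • (a₁ + n)) * ((n + 1 : ℝ)⁻¹ • (a₂ + n)) *
      Ring.inverse ((n + 1 : ℝ)⁻¹ • (b + n))) Filter.atTop (nhds 1) := by
    have hinv := (NormedRing.inverse_continuousAt (1 : Aˣ)).tendsto.comp
      (tendsto_inv_smul_add_natCast b)
    simpa using ((tendsto_inv_smul_add_natCast a₁).mul (tendsto_inv_smul_add_natCast a₂)).mul hinv
  have hq' := hq.norm.mul_const |r|
  rw [norm_one, one_mul] at hq'
  obtain ⟨q, hrq, hq1⟩ := exists_between hr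
  have hq0 : 0 ≤ q := (abs_nonneg r).trans hrq.le
  refine summable_of_ratio_norm_eventually_le hq1 ?_
  filter_upwards [hq'.eventually (eventually_lt_nhds hrq)] with n hn
  rw [gaussCoeff_succ, Real.norm_of_nonneg (by positivity), Real.norm_of_nonneg (by positivity),
    pow_succ]
  generalize ((n + 1 : ℝ)⁻¹ • (a₁ + n)) * ((n + 1 : ℝ)⁻¹ • (a₂ + n)) *
    Ring.inverse ((n + 1 : ℝ)⁻¹ • (b + n)) = w at hn ⊢
  calc _ ≤ ‖w‖ * ‖gaussCoeff a₁ a₂ b n‖ * (|r| ^ n * |r|) := by gcongr; exact norm_mul_le _ _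
    _ = (‖w‖ * |r|) * (‖gaussCoeff a₁ a₂ b n‖ * |r| ^ n) := by ring
    _ ≤ _ := by gcongr

theorem summable_norm_binomCoeff_mul_pow (a : A) (r : ℝ) (hr : |r| < 1) :
    Summable fun n => ‖binomCoeff a n‖ * |r| ^ n := by
  have h1 : ∀ k : ℕ, IsUnit ((1 : A) + k) := fun k => by
    have : IsUnit (1 + k : ℝ) := IsUnit.mk0 _ (by positivity)
    simpa using this.map (algebraMap ℝ A)
  simpa only [gaussCoeff_self h1] using summable_norm_gaussCoeff_mul_pow a 1 1 r hr

theorem hasDerivAt_tsum_binomCoeff (a : A) {s : ℝ} (hs : |s| < 1) :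
    HasDerivAt (fun s : ℝ => ∑' n, s ^ n • binomCoeff a n)
      ((1 - s)⁻¹ • (a * ∑' n, s ^ n • binomCoeff a n)) s := by
  have hc := summable_norm_binomCoeff_mul_pow a
  obtain ⟨d, hd, hsum⟩ := hasDerivAt_tsum_pow_smul hc hs
  have h1s : 1 - s ≠ 0 := by linarith [(abs_lt.1 hs).2]
  suffices h : (1 - s)⁻¹ • (a * ∑' n, s ^ n • binomCoeff a n) = d from h ▸ hd
  rw [inv_smul_eq_iff₀ h1s]
  have hsucc : HasSum (fun n : ℕ => s ^ n • ((a + n) * binomCoeff a n)) d := by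
    have := (hasSum_nat_add_iff' 1).2 hsum
    rw [Finset.sum_range_one, Nat.cast_zero, zero_mul, zero_smul, sub_zero] at this
    refine this.congr_fun fun n => ?_
    rw [← succ_smul_binomCoeff_succ, smul_smul, Nat.add_sub_cancel, mul_comm, Nat.cast_succ]
  have hmul : HasSum (fun n : ℕ => s ^ n • (n * binomCoeff a n)) (s • d) := by
    refine (hsum.const_smul s).congr_fun fun n => ?_
    rcases n with _ | n
    · simp
    · have h : ((n + 1 : ℕ) : A) = algebraMap ℝ A (n + 1 : ℕ) := by simp
      rw [Nat.add_sub_cancel, h, ← Algebra.smul_def, smul_smul, smul_smul]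
      ring_nf
  have ha := (summable_pow_smul hc hs).hasSum.mul_left a
  rw [sub_smul, one_smul]
  refine ha.unique ((hsucc.sub hmul).congr_fun fun n => ?_)
  rw [← smul_sub, mul_smul_comm]
  congr 1
  ring

theorem hasSum_pow_smul_binomCoeff (a : A) {s : ℝ} (hs : |s| < 1) :
    HasSum (fun n => s ^ n • binomCoeff a n) (oneSubPow a s) := by
  have hderiv : ∀ x ∈ Metric.ball (0 : ℝ) 1, HasDerivAt
      (fun s => oneSubPow (-a) s * ∑' n, s ^ n • binomCoeff a n) 0 x := fun x hx => by
    have hx' : |x| < 1 := by simpa using hx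
    refine ((hasDerivAt_oneSubPow (-a) (abs_lt.1 hx').2).mul
      (hasDerivAt_tsum_binomCoeff a hx')).congr_deriv ?_
    rw [smul_mul_assoc, mul_smul_comm, ← smul_add]
    convert smul_zero _
    ring
  have hs' : s ∈ Metric.ball (0 : ℝ) 1 := by simpa using hs
  have hconst := Metric.isOpen_ball.is_const_of_deriv_eq_zero
    (convex_ball (0 : ℝ) 1).isPreconnected
    (fun x hx => (hderiv x hx).differentiableAt.differentiableWithinAt)
    (fun x hx => (hderiv x hx).deriv) hs' (Metric.mem_ball_self one_pos)
  have h0 : ∑' n, (0 : ℝ) ^ n • binomCoeff a n = 1 := by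
    rw [tsum_eq_single 0 fun n hn => by simp [hn]]
    simp [binomCoeff]
  rw [h0, oneSubPow_zero, one_mul] at hconst
  have h : ∑' n, s ^ n • binomCoeff a n = oneSubPow a s := by
    have hinv := oneSubPow_neg_mul a s
    linear_combination (oneSubPow a s) * hconst - (∑' n, s ^ n • binomCoeff a n) * hinv
  rw [← h]
  exact (summable_pow_smul (summable_norm_binomCoeff_mul_pow a) hs).hasSum

omit [NormedAlgebra ℝ A] [CompleteSpace A] in
theorem norm_ascPochhammer_eval_le {x : A} {y : ℝ} (hxy : ‖x‖ ≤ y) (m : ℕ) :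
    ‖(ascPochhammer A m).eval x‖ ≤ (ascPochhammer ℝ m).eval y := by
  induction m with
  | zero => simp
  | succ m ih =>
    rw [ascPochhammer_succ_eval, ascPochhammer_succ_eval]
    have hm : ‖(m : A)‖ ≤ m := by simpa using Nat.norm_cast_le (α := A) m
    exact (norm_mul_le _ _).trans (mul_le_mul ih ((norm_add_le _ _).trans (add_le_add hxy hm))
      (norm_nonneg _) ((norm_nonneg _).trans ih))

omit [CompleteSpace A] in
theorem norm_binomCoeff_le {x : A} {y : ℝ} (hxy : ‖x‖ ≤ y) (m : ℕ) :
    ‖binomCoeff x m‖ ≤ binomCoeff y m := by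
  rw [binomCoeff, binomCoeff, norm_smul, norm_inv, Real.norm_natCast, smul_eq_mul]
  gcongr
  exact norm_ascPochhammer_eval_le hxy m

theorem summable_pfaff_double_series (a c b : A) {s : ℝ} (hs : |s| < 1 / 2) :
    Summable fun p : ℕ × ℕ =>
      ((-1) ^ p.1 * s ^ (p.1 + p.2)) • (gaussCoeff a c b p.1 * binomCoeff (a + p.1) p.2) := by
  have hs1 : |s| < 1 := by linarith
  have hpos : 0 < 1 - |s| := by linarith
  have hfib (k : ℕ) : HasSum (fun m => ‖gaussCoeff a c b k‖ * |s| ^ k *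
      (|s| ^ m • binomCoeff (‖a‖ + k) m))
      (‖gaussCoeff a c b k‖ * |(|s| / (1 - |s|))| ^ k * oneSubPow ‖a‖ |s|) := by
    have h := (hasSum_pow_smul_binomCoeff (‖a‖ + k) (s := |s|) (by rwa [abs_abs])).mul_left
      (‖gaussCoeff a c b k‖ * |s| ^ k)
    rw [oneSubPow_add_natCast _ _ hs1] at h
    have e : ‖gaussCoeff a c b k‖ * |(|s| / (1 - |s|))| ^ k * oneSubPow ‖a‖ |s| =
        ‖gaussCoeff a c b k‖ * |s| ^ k * (1 - |s|)⁻¹ ^ k • oneSubPow ‖a‖ |s| := by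
      rw [abs_of_nonneg (div_nonneg (abs_nonneg s) hpos.le), div_pow, inv_pow, smul_eq_mul]
      ring
    rw [e]
    exact h
  have hmaj : Summable fun p : ℕ × ℕ => ‖gaussCoeff a c b p.1‖ * |s| ^ p.1 *
      (|s| ^ p.2 • binomCoeff (‖a‖ + p.1) p.2) := by
    refine (summable_prod_of_nonneg fun p => ?_).2 ⟨fun k => (hfib k).summable, ?_⟩
    · have : 0 ≤ binomCoeff (‖a‖ + p.1) p.2 :=
        (norm_nonneg _).trans (norm_binomCoeff_le (Real.norm_of_nonneg (by positivity)).le _)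
      simp only [Pi.zero_apply, smul_eq_mul]
      positivity
    · simp only [(hfib _).tsum_eq]
      refine (summable_norm_gaussCoeff_mul_pow a c b _ ?_).mul_right _
      rw [abs_of_nonneg (div_nonneg (abs_nonneg s) hpos.le), div_lt_one hpos]
      linarith
  refine .of_norm_bounded hmaj fun p => ?_
  have hk : ‖a + p.1‖ ≤ ‖a‖ + p.1 :=
    (norm_add_le _ _).trans (by gcongr; simpa using Nat.norm_cast_le (α := A) p.1)
  rw [norm_smul, norm_mul, norm_pow, norm_pow, norm_neg, norm_one, one_pow, one_mul, pow_add,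
    Real.norm_eq_abs, smul_eq_mul]
  calc _ ≤ |s| ^ p.1 * |s| ^ p.2 * (‖gaussCoeff a c b p.1‖ * binomCoeff (‖a‖ + p.1) p.2) := by
        gcongr
        exact (norm_mul_le _ _).trans (by gcongr; exact norm_binomCoeff_le hk _)
    _ = _ := by ring

omit [CompleteSpace A] [NormOneClass A] in
theorem sum_antidiagonal_gaussCoeff_mul_binomCoeff {a₁ a₂ b : A} (hb : ∀ k : ℕ, IsUnit (b + k))
    (n : ℕ) :
    ∑ p ∈ Finset.HasAntidiagonal.antidiagonal n,
      (-1 : ℝ) ^ p.1 • (gaussCoeff a₁ (b - a₂) b p.1 * binomCoeff (a₁ + p.1) p.2) =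
      gaussCoeff a₁ a₂ b n := by
  have hv := sum_antidiagonal_choose_mul_ascPochhammer n b (b - a₂)
  rw [sub_sub_cancel] at hv
  rw [gaussCoeff, ← hv, mul_right_comm, Finset.mul_sum, Finset.smul_sum]
  refine Finset.sum_congr rfl fun p hp => ?_
  rw [Finset.HasAntidiagonal.mem_antidiagonal] at hp
  have hinv : Ring.inverse ((ascPochhammer A p.1).eval b) =
      Ring.inverse ((ascPochhammer A n).eval b) * (ascPochhammer A p.2).eval (b + p.1) := by
    rw [eq_comm, mul_comm, ← hp, ← ascPochhammer_eval_add, Ring.mul_inverse_rev, ← mul_assoc,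
      Ring.mul_inverse_cancel, one_mul]
    refine isUnit_ascPochhammer_eval (fun k => ?_) _
    simpa [add_assoc] using hb (p.1 + k)
  have hfac : ((p.1.factorial : ℝ)⁻¹ * (p.2.factorial : ℝ)⁻¹) =
      (n.factorial : ℝ)⁻¹ * n.choose p.1 := by
    have h := Nat.add_choose_mul_factorial_mul_factorial p.1 p.2
    rw [hp, ← Nat.choose_symm_of_eq_add hp.symm] at h
    rw [← h]
    have h1 : (n.choose p.1 : ℝ) ≠ 0 := by
      exact_mod_cast (Nat.choose_pos (by omega)).ne'
    push_cast
    field_simp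
  have hcast : ((n.choose p.1 : ℕ) : A) = algebraMap ℝ A (n.choose p.1) := by simp
  rw [gaussCoeff, binomCoeff, hinv, ← hp, ← ascPochhammer_eval_add a₁, hp, smul_mul_smul_comm,
    hfac, hcast]
  simp only [Algebra.smul_def, map_mul, map_pow, map_neg, map_one]
  ring

theorem tsum_gaussCoeff_eq_of_abs_lt_half {a₁ a₂ b : A} (hb : ∀ k : ℕ, IsUnit (b + k)) {s : ℝ}
    (hs : |s| < 1 / 2) :
    ∑' n, s ^ n • gaussCoeff a₁ a₂ b n =
      oneSubPow a₁ s * ∑' n, (-s / (1 - s)) ^ n • gaussCoeff a₁ (b - a₂) b n := by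
  have hs1 : |s| < 1 := by linarith
  have hT := (summable_pfaff_double_series a₁ (b - a₂) b hs).hasSum
  have hrow (k : ℕ) : HasSum (fun m => ((-1) ^ k * s ^ (k + m)) •
      (gaussCoeff a₁ (b - a₂) b k * binomCoeff (a₁ + k) m))
      (oneSubPow a₁ s * (-s / (1 - s)) ^ k • gaussCoeff a₁ (b - a₂) b k) := by
    have h := ((hasSum_pow_smul_binomCoeff (a₁ + k) hs1).mul_left
      (gaussCoeff a₁ (b - a₂) b k)).const_smul ((-1) ^ k * s ^ k)
    rw [oneSubPow_add_natCast _ _ (abs_lt.1 hs1).2] at h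
    have e : oneSubPow a₁ s * (-s / (1 - s)) ^ k • gaussCoeff a₁ (b - a₂) b k =
        ((-1) ^ k * s ^ k) • (gaussCoeff a₁ (b - a₂) b k * (1 - s)⁻¹ ^ k • oneSubPow a₁ s) := by
      rw [mul_smul_comm, mul_smul_comm, smul_smul, mul_comm (oneSubPow a₁ s), div_eq_mul_inv,
        mul_pow, neg_pow]
    rw [e]
    refine h.congr_fun fun m => ?_
    rw [mul_smul_comm, smul_smul, pow_add, mul_assoc]
  have hcol (n : ℕ) := hasSum_fintype fun p : Finset.HasAntidiagonal.antidiagonal n =>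
    ((-1) ^ p.1.1 * s ^ (p.1.1 + p.1.2)) •
      (gaussCoeff a₁ (b - a₂) b p.1.1 * binomCoeff (a₁ + p.1.1) p.1.2)
  have h1 := (hT.prod_fiberwise hrow).tsum_eq
  have h2 := ((Finset.HasAntidiagonal.sigmaAntidiagonalEquivProd.hasSum_iff.2 hT).sigma
    hcol).tsum_eq
  have hd : |(-s / (1 - s))| < 1 := by
    have := abs_lt.1 hs
    rw [abs_div, abs_neg, abs_of_pos (a := 1 - s) (by linarith), div_lt_one (by linarith)]
    linarith
  rw [(summable_pow_smul (summable_norm_gaussCoeff_mul_pow a₁ (b - a₂) b) hd).tsum_mul_left,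
    ← h2] at h1
  rw [h1]
  refine tsum_congr fun n => ?_
  rw [← sum_antidiagonal_gaussCoeff_mul_binomCoeff hb n, Finset.smul_sum,
    ← Finset.sum_coe_sort (Finset.HasAntidiagonal.antidiagonal n)]
  refine Finset.sum_congr rfl fun p _ => ?_
  rw [Finset.HasAntidiagonal.mem_antidiagonal.1 p.2, smul_smul, mul_comm]

/-- Pfaff's transformation for parameters in a commutative real Banach algebra. -/
theorem tsum_gaussCoeff_eqOn {a₁ a₂ b : A} (hb : ∀ k : ℕ, IsUnit (b + k)) :
    Set.EqOn (fun s : ℝ => ∑' n, s ^ n • gaussCoeff a₁ a₂ b n)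
      (fun s => oneSubPow a₁ s * ∑' n, (-s / (1 - s)) ^ n • gaussCoeff a₁ (b - a₂) b n)
      (Set.Ioo (-1) (1 / 2)) := by
  refine AnalyticOnNhd.eqOn_of_preconnected_of_eventuallyEq (𝕜 := ℝ) (z₀ := 0)
    ((analyticOnNhd_tsum_pow_smul (summable_norm_gaussCoeff_mul_pow a₁ a₂ b)).mono fun s hs => ?_)
    (fun s hs => ?_) isPreconnected_Ioo (by norm_num) ?_
  · rw [mem_ball_zero_iff, Real.norm_eq_abs, abs_lt]
    exact ⟨hs.1, by linarith [hs.2]⟩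
  · have h1s : 0 < 1 - s := by linarith [hs.2]
    have hd : -s / (1 - s) ∈ Metric.ball (0 : ℝ) 1 := by
      rw [mem_ball_zero_iff, Real.norm_eq_abs, abs_lt, lt_div_iff₀ h1s, div_lt_one h1s]
      constructor <;> linarith [hs.1, hs.2]
    have hq : AnalyticAt ℝ (fun s : ℝ => -s / (1 - s)) s :=
      analyticAt_id.neg.div (analyticAt_const.sub analyticAt_id) h1s.ne'
    exact (analyticAt_oneSubPow a₁ (by linarith)).mul
      (AnalyticAt.fun_comp (f := fun s : ℝ => -s / (1 - s))
        (g := fun u : ℝ => ∑' n, u ^ n • gaussCoeff a₁ (b - a₂) b n)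
        (analyticOnNhd_tsum_pow_smul (summable_norm_gaussCoeff_mul_pow a₁ (b - a₂) b) _ hd) hq)
  · filter_upwards [Metric.ball_mem_nhds (0 : ℝ) one_half_pos] with s hs
    exact tsum_gaussCoeff_eq_of_abs_lt_half hb (by simpa using hs)

end Hypergeometric

theorem dualPoch_eq_ascPochhammer_eval (x : DualNumber ℝ) (k : ℕ) :
    dualPoch x k = (ascPochhammer (DualNumber ℝ) k).eval x := by
  induction k with
  | zero => simp [dualPoch]
  | succ k ih => rw [dualPoch, ih, ascPochhammer_succ_eval]

theorem dualNumber_pow_eq (u : DualNumber ℝ) (k : ℕ) :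
    u ^ k = u.fst ^ k • 1 + (k * u.fst ^ (k - 1)) • (u.snd • ε) := by
  ext
  · simp
  · simp [TrivSqZeroExt.snd_pow]
    ring

theorem exists_hasDerivAt_dualGaussHyper_eq (a₁ a₂ b u : DualNumber ℝ) (hu : |u.fst| < 1) :
    ∃ d : DualNumber ℝ,
      HasDerivAt (fun s : ℝ => ∑' n, s ^ n • gaussCoeff a₁ a₂ b n) d u.fst ∧
      dualGaussHyper a₁ a₂ b u =
        (∑' n, u.fst ^ n • gaussCoeff a₁ a₂ b n) + (u.snd • ε) * d := by
  have hc := summable_norm_gaussCoeff_mul_pow a₁ a₂ b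
  obtain ⟨d, hd, hsum⟩ := hasDerivAt_tsum_pow_smul hc hu
  refine ⟨d, hd, ?_⟩
  refine (((summable_pow_smul hc hu).hasSum.add
    (hsum.mul_left (u.snd • ε))).congr_fun fun n => ?_).tsum_eq
  rw [gaussCoeff, ← dualPoch_eq_ascPochhammer_eval, ← dualPoch_eq_ascPochhammer_eval,
    ← dualPoch_eq_ascPochhammer_eval, ← smul_mul_assoc, dualNumber_pow_eq, mul_add,
    mul_smul_comm, mul_smul_comm, mul_one, mul_comm (u.snd • ε)]
  simp only [smul_mul_assoc]

theorem dualPow_one_sub_neg (a x : DualNumber ℝ) (hx : x.fst < 1) :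
    dualPow (1 - x) (-a) = oneSubPow a x.fst +
      (x.snd • ε) * ((1 - x.fst)⁻¹ • (a * oneSubPow a x.fst)) := by
  have h : 0 < 1 - x.fst := by linarith
  have e : (1 - x.fst) ^ (-a.fst) = NormedSpace.exp (-(Real.log (1 - x.fst) * a.fst)) := by
    rw [Real.rpow_def_of_pos h, Real.exp_eq_exp_ℝ, mul_neg]
  ext
  · simp [dualPow, oneSubPow, e]
  · simp [dualPow, oneSubPow, e]
    field_simp

theorem neg_mul_inverse_one_sub (x : DualNumber ℝ) (hx : x.fst < 1) :
    -x * Ring.inverse (1 - x) =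
      inl (-x.fst / (1 - x.fst)) - (x.snd / (1 - x.fst) ^ 2) • ε := by
  have h : 1 - x.fst ≠ 0 := by linarith
  have hu : IsUnit (1 - x) := by
    rw [TrivSqZeroExt.isUnit_iff_isUnit_fst]
    simpa using h
  rw [eq_comm, Ring.eq_mul_inverse_iff_mul_eq _ _ _ hu]
  ext
  · simp [h]
  · simp
    field_simp
    ring

/-- The dual Pfaff transformation:
`₂F₁(â₁, â₂; b̂; x̂) = (1 - x̂)^{-â₁} ₂F₁(â₁, b̂ - â₂; b̂; -x̂/(1 - x̂))`. -/
theorem dual_pfaff_transformation (a₁ a₂ b x : DualNumber ℝ)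
    (hb : ∀ n : ℕ, b.fst ≠ -n) (hx : |x.fst| < 1) (hx' : |x.fst / (1 - x.fst)| < 1) :
    dualGaussHyper a₁ a₂ b x =
      dualPow (1 - x) (-a₁) *
        dualGaussHyper a₁ (b - a₂) b (-x * Ring.inverse (1 - x)) := by
  have hx1 : x.fst < 1 := (abs_lt.1 hx).2
  have hpos : 0 < 1 - x.fst := by linarith
  have hmem : x.fst ∈ Set.Ioo (-1 : ℝ) (1 / 2) := by
    have := (abs_lt.1 hx').2
    rw [div_lt_one hpos] at this
    exact ⟨(abs_lt.1 hx).1, by linarith⟩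
  have hunit (k : ℕ) : IsUnit (b + k) := by
    rw [TrivSqZeroExt.isUnit_iff_isUnit_fst, isUnit_iff_ne_zero]
    simpa [← eq_neg_iff_add_eq_zero] using hb k
  have heq := tsum_gaussCoeff_eqOn (a₁ := a₁) (a₂ := a₂) hunit
  have hu : (-x * Ring.inverse (1 - x)).fst = -x.fst / (1 - x.fst) := by
    simp [neg_mul_inverse_one_sub x hx1]
  have hu' : (-x * Ring.inverse (1 - x)).snd = -(x.snd / (1 - x.fst) ^ 2) := by
    simp [neg_mul_inverse_one_sub x hx1]
  obtain ⟨d, hd, hF⟩ := exists_hasDerivAt_dualGaussHyper_eq a₁ a₂ b x hx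
  obtain ⟨d', hd', hG⟩ := exists_hasDerivAt_dualGaussHyper_eq a₁ (b - a₂) b
    (-x * Ring.inverse (1 - x)) (by rwa [hu, neg_div, abs_neg])
  rw [hu] at hd'
  rw [hu, hu'] at hG
  have hq : HasDerivAt (fun s : ℝ => -s / (1 - s)) (-(1 / (1 - x.fst) ^ 2)) x.fst := by
    refine ((hasDerivAt_neg x.fst).div ((hasDerivAt_id x.fst).const_sub 1)
      hpos.ne').congr_deriv ?_
    simp only [id]
    field_simp
    ring
  have hR := (hasDerivAt_oneSubPow a₁ hx1).mul (hd'.scomp x.fst hq)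
  have hdd := hd.unique
    (hR.congr_of_eventuallyEq (heq.eventuallyEq_of_mem (isOpen_Ioo.mem_nhds hmem)))
  have hval := heq hmem
  simp only [Function.comp_apply] at hval hdd
  rw [hF, hG, hval, hdd, dualPow_one_sub_neg a₁ x hx1]
  rw [div_eq_mul_one_div x.snd]
  generalize oneSubPow a₁ x.fst = p
  generalize 1 / (1 - x.fst) ^ 2 = w
  generalize (∑' n, (-x.fst / (1 - x.fst)) ^ n • gaussCoeff a₁ (b - a₂) b n) = g
  simp only [Algebra.smul_def, map_mul, map_neg]
  linear_combination (algebraMap ℝ (DualNumber ℝ) x.snd ^ 2 * algebraMap ℝ _ w *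
    algebraMap ℝ _ (1 - x.fst)⁻¹ * a₁ * p * d') * DualNumber.eps_mul_eps (R := ℝ)
end

section
/- (Euler integral representation of the dual Gauss hypergeometric function.) Let â₁ = a₁ + ε a₁′, â₂ = a₂ + ε a₂′, b̂ = b + ε b′ be real dual numbers with a₁ > 0, b − a₁ > 0, and b not equal to 0, −1, −2, …, and let x̂ = x₁ + ε x₂ with |x₁| < 1. Define the real integrand r(u) := u^{a₁−1}(1−u)^{b−a₁−1}(1−u x₁)^{−a₂} on (0,1), and the dual-part integrand s(u) := r(u)·( a₁′·log u + (b′ − a₁′)·log(1−u) − a₂′·log(1−u x₁) + a₂·u x₂/(1−u x₁) ). Then Γ_d(â₁) · Γ_d(b̂ − â₁) · ₂F₁(â₁, â₂; b̂; x̂) = Γ_d(b̂) · ( inl(∫₀¹ r(u) du) + (∫₀¹ s(u) du) · ε ) in DualNumber ℝ. -/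
open TrivSqZeroExt MeasureTheory
open scoped DualNumber

open Set

theorem ascPochhammer_eval_succ_eq_mul_eval_add_one (a : ℝ) (k : ℕ) :
    (ascPochhammer ℝ (k + 1)).eval a = a * (ascPochhammer ℝ k).eval (a + 1) := by
  simp [ascPochhammer_succ_left]

/-- The derivative of the rising factorial obeys the recursion given by the product rule. -/
theorem ascPochhammer_derivative_eval_succ (a : ℝ) (k : ℕ) :
    (ascPochhammer ℝ (k + 1)).derivative.eval a =
      (ascPochhammer ℝ k).derivative.eval a * (a + k) + (ascPochhammer ℝ k).eval a := by
  simp [ascPochhammer_succ_right]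

theorem abs_ascPochhammer_eval_le {a A : ℝ} (h : |a| ≤ A) (k : ℕ) :
    |(ascPochhammer ℝ k).eval a| ≤ (ascPochhammer ℝ k).eval A := by
  induction k with
  | zero => simp
  | succ k ih =>
    rw [ascPochhammer_succ_eval, ascPochhammer_succ_eval, abs_mul]
    have h' : |a + k| ≤ A + k := (abs_add_le _ _).trans (by simpa using h)
    exact mul_le_mul ih h' (abs_nonneg _) ((abs_nonneg _).trans ih)

theorem abs_ascPochhammer_derivative_eval_le {a A : ℝ} (h : |a| ≤ A) (k : ℕ) :
    |(ascPochhammer ℝ k).derivative.eval a| ≤ (ascPochhammer ℝ k).eval (A + 1) := by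
  have hA : 0 ≤ A := (abs_nonneg _).trans h
  induction k with
  | zero => simp
  | succ k ih =>
    rw [ascPochhammer_derivative_eval_succ, ascPochhammer_succ_eval]
    have h₁ : |a + k| ≤ A + k := (abs_add_le _ _).trans (by simpa using h)
    have h₂ : |(ascPochhammer ℝ k).eval a| ≤ (ascPochhammer ℝ k).eval (A + 1) :=
      abs_ascPochhammer_eval_le (h.trans (by linarith)) k
    calc _ ≤ |(ascPochhammer ℝ k).derivative.eval a| * |a + k| + |(ascPochhammer ℝ k).eval a| := by
          rw [← abs_mul]; exact abs_add_le _ _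
      _ ≤ (ascPochhammer ℝ k).eval (A + 1) * (A + k) + (ascPochhammer ℝ k).eval (A + 1) :=
          add_le_add (mul_le_mul ih h₁ (abs_nonneg _) ((abs_nonneg _).trans ih)) h₂
      _ = _ := by ring

/-- The binomial series in terms of rising factorials. -/
theorem hasSum_ascPochhammer_div_factorial_mul_pow (a : ℝ) {y : ℝ} (hy : |y| < 1) :
    HasSum (fun k : ℕ ↦ (ascPochhammer ℝ k).eval a / k.factorial * y ^ k)
      ((1 - y) ^ (-a)) := by
  have h := (Real.one_div_one_sub_rpow_hasFPowerSeriesOnBall_zero a).hasSum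
    (y := y) (by simpa [Metric.mem_eball, edist_dist] using hy)
  have h0 : 0 ≤ 1 - y := by linarith [(abs_lt.1 hy).2]
  rw [Real.rpow_neg h0]
  simp only [zero_add, one_div, FormalMultilinearSeries.ofScalars_apply_eq, smul_eq_mul] at h
  convert! h using 3 with k
  rw [← Ring.multichoose_eq, ← Polynomial.ascPochhammer_smeval_eq_eval,
    ← Ring.factorial_nsmul_multichoose_eq_ascPochhammer, nsmul_eq_mul,
    mul_div_cancel_left₀ _ (Nat.cast_ne_zero.2 k.factorial_ne_zero)]

/-- The termwise `y`-derivative of the binomial series. -/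
theorem hasSum_ascPochhammer_div_factorial_mul_deriv_pow (a : ℝ) {y : ℝ} (hy : |y| < 1) :
    HasSum (fun k : ℕ ↦ (ascPochhammer ℝ k).eval a / k.factorial * (k * y ^ (k - 1)))
      (a * (1 - y) ^ (-a - 1)) := by
  rw [← hasSum_nat_add_iff' 1]
  have h := (hasSum_ascPochhammer_div_factorial_mul_pow (a + 1) hy).mul_left a
  convert! h using 1
  · ext k
    rw [ascPochhammer_eval_succ_eq_mul_eval_add_one, Nat.factorial_succ]
    push_cast
    have := Nat.factorial_ne_zero k
    field_simp
  · simp [sub_eq_add_neg, add_comm]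

/-- The termwise `a`-derivative of the binomial series. -/
theorem hasSum_ascPochhammer_derivative_div_factorial_mul_pow (a : ℝ) {y : ℝ} (hy : |y| < 1) :
    HasSum (fun k : ℕ ↦ (ascPochhammer ℝ k).derivative.eval a / k.factorial * y ^ k)
      (-Real.log (1 - y) * (1 - y) ^ (-a)) := by
  have h0 : 0 < 1 - y := by linarith [(abs_lt.1 hy).2]
  have hu : Summable fun k : ℕ ↦
      (ascPochhammer ℝ k).eval (|a| + 1 + 1) / k.factorial * |y| ^ k :=
    (hasSum_ascPochhammer_div_factorial_mul_pow _ (by simpa using hy)).summable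
  have hbound : ∀ (k : ℕ) (z : ℝ), z ∈ Metric.ball a 1 →
      ‖(ascPochhammer ℝ k).derivative.eval z / k.factorial * y ^ k‖ ≤
        (ascPochhammer ℝ k).eval (|a| + 1 + 1) / k.factorial * |y| ^ k := by
    intro k z hz
    have hz' : |z| ≤ |a| + 1 := by
      have h₁ := abs_add_le a (z - a)
      have h₂ : |z - a| < 1 := hz
      rw [add_sub_cancel] at h₁
      linarith
    rw [norm_mul, norm_div, norm_pow, Real.norm_natCast]
    simp only [Real.norm_eq_abs]
    gcongr
    exact abs_ascPochhammer_derivative_eval_le hz' k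
  have ha : a ∈ Metric.ball a 1 := Metric.mem_ball_self one_pos
  have hd := hasDerivAt_tsum_of_isPreconnected hu Metric.isOpen_ball
    (convex_ball a 1).isPreconnected
    (g := fun k z ↦ (ascPochhammer ℝ k).eval z / k.factorial * y ^ k)
    (fun k z _ ↦ (((ascPochhammer ℝ k).hasDerivAt z).div_const _).mul_const _) hbound ha
    (hasSum_ascPochhammer_div_factorial_mul_pow a hy).summable ha
  have hs : Summable fun k : ℕ ↦
      (ascPochhammer ℝ k).derivative.eval a / k.factorial * y ^ k :=
    .of_norm_bounded hu fun k ↦ hbound k a ha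
  have heq : (fun z ↦ ∑' k : ℕ, (ascPochhammer ℝ k).eval z / k.factorial * y ^ k) =
      fun z ↦ (1 - y) ^ (-z) :=
    funext fun z ↦ (hasSum_ascPochhammer_div_factorial_mul_pow z hy).tsum_eq
  rw [heq] at hd
  have hd' : HasDerivAt (fun z ↦ (1 - y) ^ (-z)) (-Real.log (1 - y) * (1 - y) ^ (-a)) a := by
    convert! (hasDerivAt_neg a).const_rpow h0 using 1
    ring
  rw [← hd.unique hd']
  exact hs.hasSum

theorem ofReal_beta_integrand {α β u : ℝ} (hu : u ∈ Ioo (0 : ℝ) 1) :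
    (u : ℂ) ^ ((α : ℂ) - 1) * (1 - u) ^ ((β : ℂ) - 1) =
      ((u ^ (α - 1) * (1 - u) ^ (β - 1) : ℝ) : ℂ) := by
  push_cast
  rw [Complex.ofReal_cpow hu.1.le, Complex.ofReal_cpow (by linarith [hu.2])]
  push_cast
  rfl

theorem integrableOn_beta_integrand {α β : ℝ} (hα : 0 < α) (hβ : 0 < β) :
    IntegrableOn (fun u : ℝ ↦ u ^ (α - 1) * (1 - u) ^ (β - 1)) (Ioo 0 1) := by
  have h := Complex.betaIntegral_convergent (u := α) (v := β) (by simpa) (by simpa)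
  rw [intervalIntegrable_iff_integrableOn_Ioo_of_le zero_le_one] at h
  refine IntegrableOn.congr_fun h.re (fun u hu ↦ ?_) measurableSet_Ioo
  simp only [ofReal_beta_integrand hu, RCLike.re_eq_complex_re, Complex.ofReal_re]

theorem integral_beta_integrand {α β : ℝ} (hα : 0 < α) (hβ : 0 < β) :
    Real.Gamma α * Real.Gamma β =
      Real.Gamma (α + β) * ∫ u in Ioo (0 : ℝ) 1, u ^ (α - 1) * (1 - u) ^ (β - 1) := by
  have h := Complex.Gamma_mul_Gamma_eq_betaIntegral (s := α) (t := β) (by simpa) (by simpa)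
  rw [Complex.betaIntegral, intervalIntegral.integral_of_le zero_le_one,
    integral_Ioc_eq_integral_Ioo, setIntegral_congr_fun measurableSet_Ioo
      (fun u hu ↦ ofReal_beta_integrand hu), integral_complex_ofReal, ← Complex.ofReal_add] at h
  simp only [Complex.Gamma_ofReal] at h
  exact_mod_cast h

theorem hasDerivAt_integral_beta_integrand_left {α β : ℝ} (hα : 0 < α) (hβ : 0 < β) :
    IntegrableOn (fun u : ℝ ↦ u ^ (α - 1) * (1 - u) ^ (β - 1) * Real.log u) (Ioo 0 1) ∧
      HasDerivAt (fun s ↦ ∫ u in Ioo (0 : ℝ) 1, u ^ (s - 1) * (1 - u) ^ (β - 1))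
        (∫ u in Ioo (0 : ℝ) 1, u ^ (α - 1) * (1 - u) ^ (β - 1) * Real.log u) α := by
  have hmeas : ∀ s : ℝ, Measurable fun u : ℝ ↦ u ^ (s - 1) * (1 - u) ^ (β - 1) := fun s ↦ by
    fun_prop
  refine hasDerivAt_integral_of_dominated_loc_of_deriv_le
    (F' := fun s u ↦ u ^ (s - 1) * (1 - u) ^ (β - 1) * Real.log u)
    (bound := fun u ↦ 4 / α * (u ^ (α / 4 - 1) * (1 - u) ^ (β - 1)))
    (Ioi_mem_nhds (half_lt_self hα)) (.of_forall fun s ↦ (hmeas s).aestronglyMeasurable)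
    (integrableOn_beta_integrand hα hβ)
    ((hmeas α).mul Real.measurable_log).aestronglyMeasurable ?_
    ((integrableOn_beta_integrand (by positivity) hβ).const_mul _) ?_
  · refine (ae_restrict_mem measurableSet_Ioo).mono fun u hu s hs ↦ ?_
    have h0 : 0 < u := hu.1
    have h1 : 0 ≤ 1 - u := by linarith [hu.2]
    have hlog := (Real.abs_log_mul_self_rpow_lt u (α / 4) h0 hu.2.le (by positivity)).le
    have hw : 0 ≤ (1 - u) ^ (β - 1) := Real.rpow_nonneg h1 _
    have hs' : α / 2 < s := hs
    rw [Real.norm_eq_abs, abs_mul, abs_mul, abs_of_nonneg (Real.rpow_nonneg h0.le _),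
      abs_of_nonneg hw]
    rw [abs_mul, abs_of_nonneg (Real.rpow_nonneg h0.le _)] at hlog
    calc _ ≤ u ^ (α / 4 - 1 + α / 4) * (1 - u) ^ (β - 1) * |Real.log u| := by
          gcongr ?_ * _ * _
          exact Real.rpow_le_rpow_of_exponent_ge h0 hu.2.le (by linarith)
      _ = (|Real.log u| * u ^ (α / 4)) * (u ^ (α / 4 - 1) * (1 - u) ^ (β - 1)) := by
          rw [Real.rpow_add h0]; ring
      _ ≤ 1 / (α / 4) * (u ^ (α / 4 - 1) * (1 - u) ^ (β - 1)) := by gcongr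
      _ = _ := by rw [one_div_div]
  · refine (ae_restrict_mem measurableSet_Ioo).mono fun u hu s _ ↦ ?_
    have h := (((hasDerivAt_id s).sub_const 1).const_rpow hu.1).mul_const ((1 - u) ^ (β - 1))
    convert! h using 1
    simp only [id]; ring

theorem integral_Ioo_comp_one_sub (f : ℝ → ℝ) :
    ∫ u in Ioo (0 : ℝ) 1, f (1 - u) = ∫ u in Ioo (0 : ℝ) 1, f u := by
  simp only [← integral_Ioc_eq_integral_Ioo, ← intervalIntegral.integral_of_le zero_le_one]
  simp

theorem hasDerivAt_integral_beta_integrand_right {α β : ℝ} (hα : 0 < α) (hβ : 0 < β) :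
    IntegrableOn (fun u : ℝ ↦ u ^ (α - 1) * (1 - u) ^ (β - 1) * Real.log (1 - u)) (Ioo 0 1) ∧
      HasDerivAt (fun s ↦ ∫ u in Ioo (0 : ℝ) 1, u ^ (α - 1) * (1 - u) ^ (s - 1))
        (∫ u in Ioo (0 : ℝ) 1, u ^ (α - 1) * (1 - u) ^ (β - 1) * Real.log (1 - u)) β := by
  obtain ⟨h₁, h₂⟩ := hasDerivAt_integral_beta_integrand_left hβ hα
  constructor
  · rw [← intervalIntegrable_iff_integrableOn_Ioo_of_le zero_le_one] at h₁ ⊢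
    have h := (h₁.comp_sub_left 1).symm
    simpa [mul_comm] using h
  · convert! h₂ using 1
    · ext s
      rw [← integral_Ioo_comp_one_sub]
      simp [mul_comm]
    · rw [← integral_Ioo_comp_one_sub]
      simp [mul_comm]

theorem hasDerivAt_Gamma_of_pos {a : ℝ} (ha : 0 < a) :
    HasDerivAt Real.Gamma (deriv Real.Gamma a) a :=
  (Real.differentiableAt_Gamma fun m ↦
    ((neg_nonpos.2 m.cast_nonneg).trans_lt ha).ne').hasDerivAt

theorem fst_dualGamma (a a' : ℝ) : (dualGamma a a').fst = Real.Gamma a := by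
  simp [dualGamma]

theorem snd_dualGamma (a a' : ℝ) : (dualGamma a a').snd = a' * deriv Real.Gamma a := by
  simp [dualGamma]

/-- The dual beta integral. -/
theorem dualGamma_mul_dualGamma {α β : ℝ} (α' β' : ℝ) (hα : 0 < α) (hβ : 0 < β) :
    dualGamma α α' * dualGamma β β' = dualGamma (α + β) (α' + β') *
      (inl (∫ u in Ioo (0 : ℝ) 1, u ^ (α - 1) * (1 - u) ^ (β - 1)) +
        (∫ u in Ioo (0 : ℝ) 1, u ^ (α - 1) * (1 - u) ^ (β - 1) *
          (α' * Real.log u + β' * Real.log (1 - u))) • ε) := by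
  obtain ⟨hi₁, hd₁⟩ := hasDerivAt_integral_beta_integrand_left hα hβ
  obtain ⟨hi₂, hd₂⟩ := hasDerivAt_integral_beta_integrand_right hα hβ
  have hG := hasDerivAt_Gamma_of_pos (add_pos hα hβ)
  have hα_nhds : ∀ᶠ s in nhds α, 0 < s := lt_mem_nhds hα
  have hβ_nhds : ∀ᶠ s in nhds β, 0 < s := lt_mem_nhds hβ
  have e₁ := ((hasDerivAt_Gamma_of_pos hα).mul_const (Real.Gamma β)).unique
    (((hG.comp_add_const α β).mul hd₁).congr_of_eventuallyEq
      (hα_nhds.mono fun s hs ↦ integral_beta_integrand hs hβ))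
  have e₂ := ((hasDerivAt_Gamma_of_pos hβ).const_mul (Real.Gamma α)).unique
    (((hG.comp_const_add α β).mul hd₂).congr_of_eventuallyEq
      (hβ_nhds.mono fun s hs ↦ integral_beta_integrand hα hs))
  have hsplit : ∫ u in Ioo (0 : ℝ) 1, u ^ (α - 1) * (1 - u) ^ (β - 1) *
        (α' * Real.log u + β' * Real.log (1 - u)) =
      α' * (∫ u in Ioo (0 : ℝ) 1, u ^ (α - 1) * (1 - u) ^ (β - 1) * Real.log u) +
      β' * ∫ u in Ioo (0 : ℝ) 1, u ^ (α - 1) * (1 - u) ^ (β - 1) * Real.log (1 - u) := by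
    rw [← integral_const_mul, ← integral_const_mul,
      ← integral_add (hi₁.const_mul _) (hi₂.const_mul _)]
    congr 1 with u
    ring
  ext
  · simpa [fst_dualGamma] using integral_beta_integrand hα hβ
  · simp only [snd_mul, fst_dualGamma, snd_dualGamma, fst_add, snd_add, fst_inl, snd_inl, fst_smul,
      snd_smul, DualNumber.fst_eps, DualNumber.snd_eps, smul_eq_mul, MulOpposite.smul_eq_mul_unop,
      MulOpposite.unop_op, hsplit]
    linear_combination α' * e₁ + β' * e₂

/-- The functional equation of the dual gamma function, iterated. -/
theorem dualGamma_add_natCast {a : ℝ} (a' : ℝ) (ha : 0 < a) (k : ℕ) :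
    dualGamma (a + k) a' = dualGamma a a' * dualPoch (inl a + a' • ε) k := by
  induction k with
  | zero => simp [dualPoch]
  | succ k ih =>
    have hpos : 0 < a + k := by positivity
    have hd := ((hasDerivAt_Gamma_of_pos (show 0 < a + k + 1 by positivity)).comp_add_const
      (a + k) 1).unique (((hasDerivAt_id (a + k)).mul
        (hasDerivAt_Gamma_of_pos hpos)).congr_of_eventuallyEq
          ((lt_mem_nhds hpos).mono fun s hs ↦ Real.Gamma_add_one hs.ne'))
    rw [dualPoch, ← mul_assoc, ← ih, Nat.cast_succ, ← add_assoc]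
    ext
    · simp [fst_dualGamma, Real.Gamma_add_one hpos.ne', mul_comm]
    · simp [fst_dualGamma, snd_dualGamma, hd]
      ring

theorem fst_dualPoch (a a' : ℝ) (k : ℕ) :
    (dualPoch (inl a + a' • ε) k).fst = (ascPochhammer ℝ k).eval a := by
  induction k with
  | zero => simp [dualPoch]
  | succ k ih => simp [dualPoch, ih, ascPochhammer_succ_eval]

theorem snd_dualPoch (a a' : ℝ) (k : ℕ) :
    (dualPoch (inl a + a' • ε) k).snd = a' * (ascPochhammer ℝ k).derivative.eval a := by
  induction k with
  | zero => simp [dualPoch]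
  | succ k ih =>
    simp [dualPoch, ih, fst_dualPoch, ascPochhammer_derivative_eval_succ]
    ring

/-- Termwise integration of an absolutely convergent power series on `(0, 1)` against an
integrable weight. -/
theorem hasSum_integral_powerSeries_mul {w G : ℝ → ℝ} {c : ℕ → ℝ} (hw : IntegrableOn w (Ioo 0 1))
    (hc : Summable c) (hG : ∀ u ∈ Ioo (0 : ℝ) 1, HasSum (fun k ↦ c k * u ^ k) (G u))
    (hGc : ContinuousOn G (Ioo 0 1)) :
    IntegrableOn (fun u ↦ G u * w u) (Ioo 0 1) ∧
      HasSum (fun k ↦ c k * ∫ u in Ioo (0 : ℝ) 1, u ^ k * w u)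
        (∫ u in Ioo (0 : ℝ) 1, G u * w u) := by
  have hterm : ∀ k, ∀ u ∈ Ioo (0 : ℝ) 1, ‖c k * u ^ k‖ ≤ |c k| := fun k u hu ↦ by
    rw [norm_mul, Real.norm_eq_abs, norm_pow, Real.norm_of_nonneg hu.1.le]
    exact mul_le_of_le_one_right (abs_nonneg _) (pow_le_one₀ hu.1.le hu.2.le)
  have hG_le : ∀ u ∈ Ioo (0 : ℝ) 1, ‖G u‖ ≤ ∑' k, |c k| := fun u hu ↦ by
    rw [← (hG u hu).tsum_eq]
    exact tsum_of_norm_bounded hc.abs.hasSum fun k ↦ hterm k u hu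
  refine ⟨Integrable.bdd_mul hw (hGc.aestronglyMeasurable measurableSet_Ioo)
    ((ae_restrict_mem measurableSet_Ioo).mono hG_le), ?_⟩
  simp only [← integral_const_mul]
  refine hasSum_integral_of_dominated_convergence (fun k u ↦ |c k| * |w u|)
    (fun k ↦ ?_) (fun k ↦ ?_) (.of_forall fun u ↦ hc.abs.mul_right _) ?_ ?_
  · exact ((by fun_prop : Continuous fun u : ℝ ↦ u ^ k).aestronglyMeasurable.mul
      hw.aestronglyMeasurable).const_mul _
  · refine (ae_restrict_mem measurableSet_Ioo).mono fun u hu ↦ ?_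
    rw [← mul_assoc, norm_mul, Real.norm_eq_abs (w u)]
    exact mul_le_mul_of_nonneg_right (hterm k u hu) (abs_nonneg _)
  · simp only [tsum_mul_right]
    exact hw.abs.const_mul _
  · refine (ae_restrict_mem measurableSet_Ioo).mono fun u hu ↦ ?_
    simpa only [mul_assoc] using (hG u hu).mul_right (w u)

theorem hasSum_dualNumber {ι : Type*} {f g : ι → ℝ} {a b : ℝ} (hf : HasSum f a)
    (hg : HasSum g b) :
    HasSum (fun i ↦ (inl (f i) + g i • ε : DualNumber ℝ)) (inl a + b • ε) :=
  (hasSum_inl ℝ hf).add (hg.smul_const ε)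

theorem fst_dual_pow (x x' : ℝ) (k : ℕ) :
    ((inl x + x' • ε : DualNumber ℝ) ^ k).fst = x ^ k := by
  simp

theorem snd_dual_pow (x x' : ℝ) (k : ℕ) :
    ((inl x + x' • ε : DualNumber ℝ) ^ k).snd = k * x ^ (k - 1) * x' := by
  simp [snd_pow]
  ring

theorem abs_mul_lt_one {u x : ℝ} (hu : u ∈ Ioo (0 : ℝ) 1) (hx : |x| < 1) : |u * x| < 1 := by
  rw [abs_mul, abs_of_pos hu.1]
  exact mul_lt_one_of_nonneg_of_lt_one_left hu.1.le hu.2 hx.le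

theorem one_sub_mul_pos {u x : ℝ} (hu : u ∈ Ioo (0 : ℝ) 1) (hx : |x| < 1) : 0 < 1 - u * x := by
  linarith [(abs_lt.1 (abs_mul_lt_one hu hx)).2]

/-- The `ε`-coefficient of the `k`-th coefficient of the binomial series of `(1 - u x̂)^(-â)` in
powers of `u`. -/
noncomputable def dualBinomialCoeffSnd (a a' x x' : ℝ) (k : ℕ) : ℝ :=
  a' * ((ascPochhammer ℝ k).derivative.eval a / k.factorial * x ^ k) +
    x' * ((ascPochhammer ℝ k).eval a / k.factorial * (k * x ^ (k - 1)))

theorem dualBinomialCoeff_eq (a a' x x' : ℝ) (k : ℕ) :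
    (k.factorial : ℝ)⁻¹ • (dualPoch (inl a + a' • ε) k * (inl x + x' • ε : DualNumber ℝ) ^ k) =
      inl ((ascPochhammer ℝ k).eval a / k.factorial * x ^ k) +
        dualBinomialCoeffSnd a a' x x' k • ε := by
  ext
  · rw [fst_smul, fst_mul, fst_dualPoch, fst_dual_pow]
    simp
    ring
  · rw [snd_smul, snd_mul, fst_dualPoch, snd_dualPoch, fst_dual_pow, snd_dual_pow]
    simp [dualBinomialCoeffSnd]
    ring

theorem summable_dualBinomialCoeffSnd (a a' x' : ℝ) {x : ℝ} (hx : |x| < 1) :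
    Summable (dualBinomialCoeffSnd a a' x x') :=
  ((hasSum_ascPochhammer_derivative_div_factorial_mul_pow a hx).summable.mul_left _).add
    ((hasSum_ascPochhammer_div_factorial_mul_deriv_pow a hx).summable.mul_left _)

theorem hasSum_dualBinomialCoeffSnd_mul_pow (a a' x' : ℝ) {x u : ℝ} (hx : |x| < 1)
    (hu : u ∈ Ioo (0 : ℝ) 1) :
    HasSum (fun k ↦ dualBinomialCoeffSnd a a' x x' k * u ^ k)
      ((1 - u * x) ^ (-a) * (-a' * Real.log (1 - u * x) + a * u * x' / (1 - u * x))) := by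
  have hux := abs_mul_lt_one hu hx
  have h := ((hasSum_ascPochhammer_derivative_div_factorial_mul_pow a hux).mul_left a').add
    ((hasSum_ascPochhammer_div_factorial_mul_deriv_pow a hux).mul_left (x' * u))
  convert! h using 1
  · ext k
    rcases k with _ | k
    · simp [dualBinomialCoeffSnd]
    · simp [dualBinomialCoeffSnd, mul_pow]
      ring
  · rw [Real.rpow_sub_one (one_sub_mul_pos hu hx).ne']
    ring

/-- Termwise integration of the dual binomial series against a dual weight `w + ε w'`. -/
theorem hasSum_dualBinomialCoeff_mul_moment (a a' x' : ℝ) {x : ℝ} (hx : |x| < 1) {w w' : ℝ → ℝ}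
    (hw : IntegrableOn w (Ioo 0 1)) (hw' : IntegrableOn w' (Ioo 0 1)) :
    HasSum (fun k : ℕ ↦ (k.factorial : ℝ)⁻¹ •
        (dualPoch (inl a + a' • ε) k * (inl x + x' • ε : DualNumber ℝ) ^ k) *
          (inl (∫ u in Ioo (0 : ℝ) 1, u ^ k * w u) +
            (∫ u in Ioo (0 : ℝ) 1, u ^ k * w' u) • ε))
      (inl (∫ u in Ioo (0 : ℝ) 1, (1 - u * x) ^ (-a) * w u) +
        (∫ u in Ioo (0 : ℝ) 1, ((1 - u * x) ^ (-a) * w' u + (1 - u * x) ^ (-a) *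
          (-a' * Real.log (1 - u * x) + a * u * x' / (1 - u * x)) * w u)) • ε) := by
  have hne : ∀ u ∈ Ioo (0 : ℝ) 1, 1 - u * x ≠ 0 := fun u hu ↦ (one_sub_mul_pos hu hx).ne'
  have hlin : ContinuousOn (fun u : ℝ ↦ 1 - u * x) (Ioo 0 1) := by fun_prop
  have hGc : ContinuousOn (fun u : ℝ ↦ (1 - u * x) ^ (-a)) (Ioo 0 1) :=
    hlin.rpow_const fun u hu ↦ .inl (hne u hu)
  have hHc : ContinuousOn (fun u : ℝ ↦ (1 - u * x) ^ (-a) *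
      (-a' * Real.log (1 - u * x) + a * u * x' / (1 - u * x))) (Ioo 0 1) :=
    hGc.mul (((hlin.log hne).const_mul _).add (ContinuousOn.div (by fun_prop) hlin hne))
  have hG : ∀ u ∈ Ioo (0 : ℝ) 1, HasSum
      (fun k : ℕ ↦ (ascPochhammer ℝ k).eval a / k.factorial * x ^ k * u ^ k)
        ((1 - u * x) ^ (-a)) := fun u hu ↦ by
    convert! hasSum_ascPochhammer_div_factorial_mul_pow a (abs_mul_lt_one hu hx) using 2 with k
    ring
  have hp := (hasSum_ascPochhammer_div_factorial_mul_pow a hx).summable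
  obtain ⟨-, h₁⟩ := hasSum_integral_powerSeries_mul hw hp hG hGc
  obtain ⟨hi₂, h₂⟩ := hasSum_integral_powerSeries_mul hw' hp hG hGc
  obtain ⟨hi₃, h₃⟩ := hasSum_integral_powerSeries_mul hw (summable_dualBinomialCoeffSnd a a' x' hx)
    (fun u hu ↦ hasSum_dualBinomialCoeffSnd_mul_pow a a' x' hx hu) hHc
  rw [integral_add hi₂ hi₃]
  convert! hasSum_dualNumber h₁ (h₂.add h₃) using 1
  ext k
  · simp [dualBinomialCoeff_eq]
  · simp [dualBinomialCoeff_eq]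

theorem isUnit_dualGamma {a : ℝ} (a' : ℝ) (ha : 0 < a) : IsUnit (dualGamma a a') := by
  rw [isUnit_iff_isUnit_fst, fst_dualGamma]
  exact (Real.Gamma_pos_of_pos ha).ne'.isUnit

theorem isUnit_dualPoch {a : ℝ} (a' : ℝ) (ha : 0 < a) (k : ℕ) :
    IsUnit (dualPoch (inl a + a' • ε) k) := by
  rw [isUnit_iff_isUnit_fst, fst_dualPoch]
  exact (ascPochhammer_pos k a ha).ne'.isUnit

/-- The quotient of dual shifted factorials as a normalized dual beta moment. -/
theorem dualGamma_mul_dualPoch_mul_inverse {α β : ℝ} (α' β' : ℝ) (hα : 0 < α) (hβ : 0 < β)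
    (k : ℕ) :
    dualGamma α α' * dualGamma β β' * (dualPoch (inl α + α' • ε) k *
        Ring.inverse (dualPoch (inl (α + β) + (α' + β') • ε) k)) =
      dualGamma (α + β) (α' + β') *
        (inl (∫ u in Ioo (0 : ℝ) 1, u ^ k * (u ^ (α - 1) * (1 - u) ^ (β - 1))) +
          (∫ u in Ioo (0 : ℝ) 1, u ^ k * (u ^ (α - 1) * (1 - u) ^ (β - 1) *
            (α' * Real.log u + β' * Real.log (1 - u)))) • ε) := by
  have hpow : ∀ u ∈ Ioo (0 : ℝ) 1, u ^ (α + k - 1) = u ^ k * u ^ (α - 1) := fun u hu ↦ by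
    rw [add_sub_right_comm, Real.rpow_add_natCast hu.1.ne', mul_comm]
  have hM : ∫ u in Ioo (0 : ℝ) 1, u ^ (α + k - 1) * (1 - u) ^ (β - 1) =
      ∫ u in Ioo (0 : ℝ) 1, u ^ k * (u ^ (α - 1) * (1 - u) ^ (β - 1)) :=
    setIntegral_congr_fun measurableSet_Ioo fun u hu ↦ by simp only [hpow u hu, mul_assoc]
  have hN : ∫ u in Ioo (0 : ℝ) 1, u ^ (α + k - 1) * (1 - u) ^ (β - 1) *
        (α' * Real.log u + β' * Real.log (1 - u)) =
      ∫ u in Ioo (0 : ℝ) 1, u ^ k * (u ^ (α - 1) * (1 - u) ^ (β - 1) *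
        (α' * Real.log u + β' * Real.log (1 - u))) :=
    setIntegral_congr_fun measurableSet_Ioo fun u hu ↦ by simp only [hpow u hu, mul_assoc]
  have h := dualGamma_mul_dualGamma α' β' (show 0 < α + k by positivity) hβ
  rw [dualGamma_add_natCast α' hα, add_right_comm, dualGamma_add_natCast _ (add_pos hα hβ),
    hM, hN] at h
  have hinv := Ring.mul_inverse_cancel _ (isUnit_dualPoch (α' + β') (add_pos hα hβ) k)
  linear_combination Ring.inverse (dualPoch (inl (α + β) + (α' + β') • ε) k) * h +
    dualGamma (α + β) (α' + β') * (inl (∫ u in Ioo (0 : ℝ) 1, u ^ k * (u ^ (α - 1) *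
      (1 - u) ^ (β - 1))) + (∫ u in Ioo (0 : ℝ) 1, u ^ k * (u ^ (α - 1) * (1 - u) ^ (β - 1) *
        (α' * Real.log u + β' * Real.log (1 - u)))) • ε) * hinv

/-- The Euler integral representation of the dual Gauss hypergeometric function. -/
theorem dual_gauss_euler_integral (a₁ a₁' a₂ a₂' b b' x₁ x₂ : ℝ)
    (ha₁ : 0 < a₁) (hba : 0 < b - a₁) (hb : ∀ n : ℕ, b ≠ -n) (hx : |x₁| < 1) :
    dualGamma a₁ a₁' * dualGamma (b - a₁) (b' - a₁') *
        dualGaussHyper (inl a₁ + a₁' • ε) (inl a₂ + a₂' • ε) (inl b + b' • ε)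
          (inl x₁ + x₂ • ε) =
      dualGamma b b' *
        (inl (∫ u in (0 : ℝ)..1,
            u ^ (a₁ - 1) * (1 - u) ^ (b - a₁ - 1) * (1 - u * x₁) ^ (-a₂)) +
          (∫ u in (0 : ℝ)..1,
              u ^ (a₁ - 1) * (1 - u) ^ (b - a₁ - 1) * (1 - u * x₁) ^ (-a₂) *
                (a₁' * Real.log u + (b' - a₁') * Real.log (1 - u) -
                  a₂' * Real.log (1 - u * x₁) + a₂ * u * x₂ / (1 - u * x₁))) • ε) := by
  obtain ⟨c, rfl⟩ : ∃ c, b = a₁ + c := ⟨b - a₁, by ring⟩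
  obtain ⟨c', rfl⟩ : ∃ c', b' = a₁' + c' := ⟨b' - a₁', by ring⟩
  simp only [add_sub_cancel_left] at hba ⊢
  simp only [intervalIntegral.integral_of_le zero_le_one, integral_Ioc_eq_integral_Ioo]
  have hw := integrableOn_beta_integrand ha₁ hba
  have hw' : IntegrableOn (fun u : ℝ ↦ u ^ (a₁ - 1) * (1 - u) ^ (c - 1) *
      (a₁' * Real.log u + c' * Real.log (1 - u))) (Ioo 0 1) := by
    refine (((hasDerivAt_integral_beta_integrand_left ha₁ hba).1.const_mul a₁').add
      ((hasDerivAt_integral_beta_integrand_right ha₁ hba).1.const_mul c')).congr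
        (.of_forall fun u ↦ ?_)
    simp only [Pi.add_apply]
    ring
  have hsum := (hasSum_dualBinomialCoeff_mul_moment a₂ a₂' x₂ hx hw hw').mul_left
    (dualGamma (a₁ + c) (a₁' + c'))
  have hunit := (isUnit_dualGamma a₁' ha₁).mul (isUnit_dualGamma c' hba)
  have hterm : ∀ k : ℕ, (k.factorial : ℝ)⁻¹ • (dualPoch (inl a₁ + a₁' • ε) k *
        dualPoch (inl a₂ + a₂' • ε) k * Ring.inverse (dualPoch (inl (a₁ + c) + (a₁' + c') • ε) k) *
          (inl x₁ + x₂ • ε : DualNumber ℝ) ^ k) =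
      Ring.inverse (dualGamma a₁ a₁' * dualGamma c c') * (dualGamma (a₁ + c) (a₁' + c') *
        ((k.factorial : ℝ)⁻¹ • (dualPoch (inl a₂ + a₂' • ε) k * (inl x₁ + x₂ • ε) ^ k) *
          (inl (∫ u in Ioo (0 : ℝ) 1, u ^ k * (u ^ (a₁ - 1) * (1 - u) ^ (c - 1))) +
            (∫ u in Ioo (0 : ℝ) 1, u ^ k * (u ^ (a₁ - 1) * (1 - u) ^ (c - 1) *
              (a₁' * Real.log u + c' * Real.log (1 - u)))) • ε))) := fun k ↦ by
    rw [mul_left_comm (dualGamma (a₁ + c) _), ← dualGamma_mul_dualPoch_mul_inverse a₁' c' ha₁ hba,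
      mul_left_comm (Ring.inverse _), ← mul_assoc (Ring.inverse _), Ring.inverse_mul_cancel _ hunit,
      one_mul, smul_mul_assoc]
    congr 1
    ring
  rw [dualGaussHyper, tsum_congr hterm, (hsum.mul_left _).tsum_eq, ← mul_assoc,
    Ring.mul_inverse_cancel _ hunit, one_mul]
  congr 4
  · ext u
    ring
  · ext u
    ring
end
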